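/- arXiv:1809.00309 — 2 statements merged into one kernel-verified Lean document; each statement's English description precedes it below -/
import Mathlib

section
/- In the one-boundary setting (ξ₂(t) ≡ X constant and u(X,t) ≠ 0 for all t ∈ [0,T]): let s ∈ (0,T) be a *ZN-moment of w₁(t) := u(ξ₁(t),t), i.e. w₁(s) = 0 and there exists ε > 0 with w₁(t) ≠ 0 for all t ∈ (s, s+ε). Assume (H3) holds at s (with i = 1) and Z(s) < ∞. Then Z(s) > Z(t) for all t > s sufficiently close to s. -/
open Set

/-- spatial partial derivative `u_x` -/
noncomputable def pdx (u : ℝ → ℝ → ℝ) (x t : ℝ) : ℝ := deriv (fun y => u y t) x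

/-- second spatial partial derivative `u_xx` -/
noncomputable def pdxx (u : ℝ → ℝ → ℝ) (x t : ℝ) : ℝ := deriv (fun y => pdx u y t) x

/-- time partial derivative `u_t` -/
noncomputable def pdt (u : ℝ → ℝ → ℝ) (x t : ℝ) : ℝ := deriv (fun s => u x s) t

/-- the closure of the space-time domain `Ω` -/
def domCl (xi1 xi2 : ℝ → ℝ) (T : ℝ) : Set (ℝ × ℝ) :=
  {p : ℝ × ℝ | p.2 ∈ Icc (0:ℝ) T ∧ p.1 ∈ Icc (xi1 p.2) (xi2 p.2)}

/-- the domain together with its lateral boundaries -/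
def domLat (xi1 xi2 : ℝ → ℝ) (T : ℝ) : Set (ℝ × ℝ) :=
  {p : ℝ × ℝ | p.2 ∈ Ioc (0:ℝ) T ∧ p.1 ∈ Icc (xi1 p.2) (xi2 p.2)}

/-- `u` is a classical solution of `u_t = a u_xx + b u_x + c u` on
`Ω = {(x,t) : ξ₁(t) < x < ξ₂(t), 0 < t ≤ T}`: it is continuous on the closure, its
partial derivatives `u_t, u_x, u_xx` exist and are continuous up to the lateral
boundaries, and the equation holds. -/
structure IsClassicalSolution (a b c : ℝ → ℝ → ℝ) (xi1 xi2 : ℝ → ℝ) (T : ℝ)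
    (u : ℝ → ℝ → ℝ) : Prop where
  cont : ContinuousOn (fun p : ℝ × ℝ => u p.1 p.2) (domCl xi1 xi2 T)
  diff_x : ∀ p ∈ domLat xi1 xi2 T, DifferentiableAt ℝ (fun y => u y p.2) p.1
  diff_xx : ∀ p ∈ domLat xi1 xi2 T, DifferentiableAt ℝ (fun y => pdx u y p.2) p.1
  diff_t : ∀ p ∈ domLat xi1 xi2 T, DifferentiableAt ℝ (fun s => u p.1 s) p.2
  cont_x : ContinuousOn (fun p : ℝ × ℝ => pdx u p.1 p.2) (domLat xi1 xi2 T)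
  cont_xx : ContinuousOn (fun p : ℝ × ℝ => pdxx u p.1 p.2) (domLat xi1 xi2 T)
  cont_t : ContinuousOn (fun p : ℝ × ℝ => pdt u p.1 p.2) (domLat xi1 xi2 T)
  eqn : ∀ p ∈ domLat xi1 xi2 T,
    pdt u p.1 p.2 =
      a p.1 p.2 * pdxx u p.1 p.2 + b p.1 p.2 * pdx u p.1 p.2 + c p.1 p.2 * u p.1 p.2

/-- the regularity assumption (1.2): `a, a⁻¹, a_t, a_x, a_xx, b, b_t, b_x, c ∈ L^∞`,
with `a > 0` -/
def Reg12 (a b c : ℝ → ℝ → ℝ) (xi1 xi2 : ℝ → ℝ) (T : ℝ) : Prop :=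
  ∃ M : ℝ, ∀ p ∈ domLat xi1 xi2 T,
    0 < a p.1 p.2 ∧
    DifferentiableAt ℝ (fun y => a y p.2) p.1 ∧
    DifferentiableAt ℝ (fun y => pdx a y p.2) p.1 ∧
    DifferentiableAt ℝ (fun s => a p.1 s) p.2 ∧
    DifferentiableAt ℝ (fun y => b y p.2) p.1 ∧
    DifferentiableAt ℝ (fun s => b p.1 s) p.2 ∧
    |a p.1 p.2| ≤ M ∧ |(a p.1 p.2)⁻¹| ≤ M ∧ |pdt a p.1 p.2| ≤ M ∧ |pdx a p.1 p.2| ≤ M ∧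
    |pdxx a p.1 p.2| ≤ M ∧ |b p.1 p.2| ≤ M ∧ |pdt b p.1 p.2| ≤ M ∧ |pdx b p.1 p.2| ≤ M ∧
    |c p.1 p.2| ≤ M

/-- the set of zeroes of `u(·,t)` in `I(t) = [ξ₁(t), ξ₂(t)]` -/
def zeroSet (u : ℝ → ℝ → ℝ) (xi1 xi2 : ℝ → ℝ) (t : ℝ) : Set ℝ :=
  {x ∈ Icc (xi1 t) (xi2 t) | u x t = 0}

/-- `Z(t)`: the (extended-natural) number of zeroes of `u(·,t)` in `I(t)` -/
noncomputable def Znum (u : ℝ → ℝ → ℝ) (xi1 xi2 : ℝ → ℝ) (t : ℝ) : ℕ∞ :=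
  (zeroSet u xi1 xi2 t).encard

/-- `u(·,s)` has a multiple (degenerate) zero in `I(s)` -/
def HasMultipleZero (u : ℝ → ℝ → ℝ) (xi1 xi2 : ℝ → ℝ) (s : ℝ) : Prop :=
  ∃ x₀ ∈ Icc (xi1 s) (xi2 s), u x₀ s = 0 ∧ pdx u x₀ s = 0

/-- the boundary trace `wᵢ(t) := u(ξᵢ(t), t)` -/
def bdryTrace (u : ℝ → ℝ → ℝ) (xi : ℝ → ℝ) : ℝ → ℝ := fun t => u (xi t) t

/-- some left neighborhood of `s` consists entirely of N-moments -/
def leftN (w : ℝ → ℝ) (s : ℝ) : Prop := ∃ ε > 0, ∀ t ∈ Ioo (s - ε) s, w t ≠ 0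

/-- some left neighborhood of `s` consists entirely of Z-moments -/
def leftZ (w : ℝ → ℝ) (s : ℝ) : Prop := ∃ ε > 0, ∀ t ∈ Ioo (s - ε) s, w t = 0

/-- some right neighborhood of `s` consists entirely of N-moments -/
def rightN (w : ℝ → ℝ) (s : ℝ) : Prop := ∃ ε > 0, ∀ t ∈ Ioo s (s + ε), w t ≠ 0

/-- some right neighborhood of `s` consists entirely of Z-moments -/
def rightZ (w : ℝ → ℝ) (s : ℝ) : Prop := ∃ ε > 0, ∀ t ∈ Ioo s (s + ε), w t = 0

/-- `s` is an NZN-moment of `w` -/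
def IsNZN (w : ℝ → ℝ) (s : ℝ) : Prop := w s = 0 ∧ leftN w s ∧ rightN w s

/-- `s` is a ZZZ-moment of `w` -/
def IsZZZ (w : ℝ → ℝ) (s : ℝ) : Prop := w s = 0 ∧ leftZ w s ∧ rightZ w s

/-- `s` is an NZZ-moment of `w` -/
def IsNZZ (w : ℝ → ℝ) (s : ℝ) : Prop := w s = 0 ∧ leftN w s ∧ rightZ w s

/-- `s` is a ZZN-moment of `w` -/
def IsZZN (w : ℝ → ℝ) (s : ℝ) : Prop := w s = 0 ∧ leftZ w s ∧ rightN w s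

/-- `s` is an NZ*-moment of `w` -/
def IsNZstar (w : ℝ → ℝ) (s : ℝ) : Prop := w s = 0 ∧ leftN w s

/-- (H1): on every nondegenerate closed interval of Z-moments of the boundary trace `w`,
the boundary curve `ξ` is `C¹` -/
def H1cond (w xi : ℝ → ℝ) (T : ℝ) : Prop :=
  ∀ p q : ℝ, 0 ≤ p → p < q → q ≤ T → (∀ t ∈ Icc p q, w t = 0) → ContDiffOn ℝ 1 xi (Icc p q)

/-- (H2) at an NZ*-moment `s` of `u(ξ(·),·)`, with sign `σ = (-1)^i`:
`ξ'(s-0)` exists, and `σ · u_x(ξ(s),s) ≥ 0` (resp. `≤ 0`) if `u(ξ(t),t) > 0`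
(resp. `< 0`) shortly before `s`. -/
def H2at (u : ℝ → ℝ → ℝ) (xi : ℝ → ℝ) (σ s : ℝ) : Prop :=
  (∃ L : ℝ, HasDerivWithinAt xi L (Iio s) s) ∧
  ((∃ ε > 0, ∀ t ∈ Ioo (s - ε) s, 0 < u (xi t) t) → 0 ≤ σ * pdx u (xi s) s) ∧
  ((∃ ε > 0, ∀ t ∈ Ioo (s - ε) s, u (xi t) t < 0) → σ * pdx u (xi s) s ≤ 0)

/-- (H3) at a Z-moment `s` of `u(ξ(·),·)`, with sign `σ = (-1)^i`:
`σ · u(ξ(t),t) · u(x,s) ≤ 0` for `t` slightly after `s` and `x ∈ I(s)` near (but not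
equal to) `ξ(s)`. -/
def H3at (u : ℝ → ℝ → ℝ) (xi1 xi2 xi : ℝ → ℝ) (σ s : ℝ) : Prop :=
  ∃ ε > 0, ∃ δ > 0, ∀ t ∈ Ioo s (s + ε), ∀ x ∈ Icc (xi1 s) (xi2 s),
    x ≠ xi s → |x - xi s| < δ → σ * (u (xi t) t * u x s) ≤ 0

/-- (H3) at a Z-moment `s` for the left boundary (`i = 1`, one-boundary setting):
`-u(ξ₁(t),t) · u(x,s) ≤ 0` for `t` slightly after `s` and `x` slightly to the right
of `ξ₁(s)`. -/
def H3one (u : ℝ → ℝ → ℝ) (xi : ℝ → ℝ) (s : ℝ) : Prop :=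
  ∃ ε > 0, ∃ δ > 0, ∀ t ∈ Ioo s (s + ε), ∀ x : ℝ,
    xi s < x → x - xi s < δ → -(u (xi t) t) * u x s ≤ 0

open Filter Topology

def SupS (a b c : ℝ → ℝ → ℝ) (M : ℝ) (f : ℝ → ℝ → ℝ) (x t : ℝ) : Prop :=
  (0 < M ∧ M⁻¹ ≤ a x t ∧ a x t ≤ M ∧ |b x t| ≤ M ∧ |c x t| ≤ M) ∧
  ∃ (g : ℝ → ℝ) (ft fxx : ℝ), (∀ᶠ y in 𝓝 x, HasDerivAt (fun y => f y t) (g y) y) ∧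
    HasDerivAt g fxx x ∧ HasDerivAt (fun τ => f x τ) ft t ∧
    a x t * fxx + b x t * g x + c x t * f x t ≤ ft

theorem SupS.add {a b c : ℝ → ℝ → ℝ} {M : ℝ} {f h : ℝ → ℝ → ℝ} {x t : ℝ}
    (hf : SupS a b c M f x t) (hh : SupS a b c M h x t) :
    SupS a b c M (fun x t => f x t + h x t) x t := by
  obtain ⟨hb, g, ft, fxx, h1, h2, h3, h4⟩ := hf
  obtain ⟨-, g', ft', fxx', h1', h2', h3', h4'⟩ := hh
  refine ⟨hb, fun y => g y + g' y, ft + ft', fxx + fxx', ?_, h2.add h2', h3.add h3', ?_⟩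
  · filter_upwards [h1, h1'] with y hy hy' using hy.add hy'
  · simp only; linarith

theorem SupS.smul {a b c : ℝ → ℝ → ℝ} {M : ℝ} {f : ℝ → ℝ → ℝ} {x t k : ℝ}
    (hf : SupS a b c M f x t) (hk : 0 ≤ k) :
    SupS a b c M (fun x t => k * f x t) x t := by
  obtain ⟨hb, g, ft, fxx, h1, h2, h3, h4⟩ := hf
  refine ⟨hb, fun y => k * g y, k * ft, k * fxx, ?_, h2.const_mul k, h3.const_mul k, ?_⟩
  · filter_upwards [h1] with y hy using hy.const_mul k
  · have := mul_le_mul_of_nonneg_left h4 hk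
    simp only; linarith

theorem second_test {f g : ℝ → ℝ} {x fxx : ℝ} (h1 : ∀ᶠ y in 𝓝 x, HasDerivAt f (g y) y)
    (h2 : HasDerivAt g fxx x) (hm : IsLocalMin f x) : g x = 0 ∧ 0 ≤ fxx := by
  have e : deriv f =ᶠ[𝓝 x] g := by filter_upwards [h1] with y hy using hy.deriv
  have e2 : deriv (deriv f) x = fxx := by rw [e.deriv_eq]; exact h2.deriv
  have d0 := hm.deriv_eq_zero
  refine ⟨by rw [← e.self_of_nhds]; exact d0, ?_⟩
  by_contra hneg
  push Not at hneg
  have hM := isLocalMax_of_deriv_deriv_neg (e2 ▸ hneg) d0 h1.self_of_nhds.continuousAt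
  have hc : f =ᶠ[𝓝 x] fun _ => f x := by
    filter_upwards [hm, hM] with y a b using le_antisymm b a
  have h3 : deriv f =ᶠ[𝓝 x] fun _ => 0 := by
    have := hc.deriv
    simpa using this
  have : deriv (deriv f) x = 0 := by rw [h3.deriv_eq]; simp
  linarith

theorem time_test {g : ℝ → ℝ} {t d L : ℝ} (h : HasDerivAt g d t)
    (hl : ∀ᶠ τ in 𝓝[<] t, Real.exp (-L * t) * g t ≤ Real.exp (-L * τ) * g τ) : d ≤ L * g t := by
  have h1 : HasDerivAt (fun τ => Real.exp (-L * τ) * g τ)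
      (Real.exp (-L * t) * (-L * 1) * g t + Real.exp (-L * t) * d) t :=
    (((hasDerivAt_id t).const_mul (-L)).exp).mul h
  have h2 := h1.hasDerivWithinAt (s := Iio t)
  rw [hasDerivWithinAt_iff_tendsto_slope' (by simp)] at h2
  have h3 : Real.exp (-L * t) * (-L * 1) * g t + Real.exp (-L * t) * d ≤ 0 := by
    refine le_of_tendsto h2 ?_
    filter_upwards [hl, self_mem_nhdsWithin] with τ h4 h5
    rw [slope_def_field]
    exact div_nonpos_of_nonneg_of_nonpos (by linarith) (by simp at h5; linarith)
  have h4 : Real.exp (-L * t) * (d - L * g t) ≤ 0 := by linarith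
  have := Real.exp_pos (-L * t)
  nlinarith

theorem core_lemma {a b c : ℝ → ℝ → ℝ} {M : ℝ} {f : ℝ → ℝ → ℝ} {x t : ℝ}
    (hf : SupS a b c M f x t) (hneg : f x t < 0) (hx : ∀ᶠ y in 𝓝 x, f x t ≤ f y t)
    (hl : ∀ᶠ τ in 𝓝[<] t, Real.exp (-(M+1) * t) * f x t ≤ Real.exp (-(M+1) * τ) * f x τ) :
    False := by
  obtain ⟨⟨hM, ha, -, -, hc⟩, g, ft, fxx, h1, h2, h3, h4⟩ := hf
  obtain ⟨e1, e2⟩ := second_test h1 h2 hx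
  have e3 := time_test (g := fun τ => f x τ) h3 hl
  rw [e1] at h4
  have := abs_le.1 hc
  have : 0 ≤ a x t * fxx := mul_nonneg ((inv_pos.2 hM).le.trans ha) e2
  nlinarith

theorem weak_max {a b c : ℝ → ℝ → ℝ} {M : ℝ} {f : ℝ → ℝ → ℝ} {l r : ℝ → ℝ} {t1 t2 : ℝ}
    (hl : ContinuousOn l (Icc t1 t2)) (hr : ContinuousOn r (Icc t1 t2))
    (hc : ContinuousOn (fun p : ℝ × ℝ => f p.1 p.2)
      {p : ℝ × ℝ | p.2 ∈ Icc t1 t2 ∧ p.1 ∈ Icc (l p.2) (r p.2)})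
    (hS : ∀ t ∈ Ioc t1 t2, ∀ x ∈ Ioo (l t) (r t), SupS a b c M f x t)
    (h0 : ∀ x ∈ Icc (l t1) (r t1), 0 ≤ f x t1)
    (hL : ∀ t ∈ Icc t1 t2, l t ≤ r t → 0 ≤ f (l t) t)
    (hR : ∀ t ∈ Icc t1 t2, l t ≤ r t → 0 ≤ f (r t) t) :
    ∀ t ∈ Icc t1 t2, ∀ x ∈ Icc (l t) (r t), 0 ≤ f x t := by
  intro t ht x hx
  set R : Set (ℝ × ℝ) := {p : ℝ × ℝ | p.2 ∈ Icc t1 t2 ∧ p.1 ∈ Icc (l p.2) (r p.2)} with hRdef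
  by_contra hneg
  push Not at hneg
  have hcomp : IsCompact R := by
    obtain ⟨A, hA⟩ := (isCompact_Icc.image_of_continuousOn hl).bddBelow
    obtain ⟨B, hB⟩ := (isCompact_Icc.image_of_continuousOn hr).bddAbove
    have hcl : IsClosed R := by
      have hst : IsClosed {p : ℝ × ℝ | p.2 ∈ Icc t1 t2} := isClosed_Icc.preimage continuous_snd
      have h1 : ContinuousOn (fun p : ℝ × ℝ => l p.2) {p : ℝ × ℝ | p.2 ∈ Icc t1 t2} :=
        hl.comp continuousOn_snd (fun p hp => hp)
      have h2 : ContinuousOn (fun p : ℝ × ℝ => r p.2) {p : ℝ × ℝ | p.2 ∈ Icc t1 t2} :=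
        hr.comp continuousOn_snd (fun p hp => hp)
      have c1 := hst.isClosed_le h1 continuousOn_fst
      have c2 := hst.isClosed_le continuousOn_fst h2
      convert c1.inter c2 using 1
      ext p; simp only [hRdef, mem_ofPred_eq, mem_Icc, mem_inter_iff]; tauto
    refine (isCompact_Icc.prod isCompact_Icc : IsCompact (Icc A B ×ˢ Icc t1 t2)).of_isClosed_subset hcl ?_
    rintro ⟨y, τ⟩ ⟨h1, h2⟩
    exact ⟨⟨(hA ⟨τ, h1, rfl⟩).trans h2.1, h2.2.trans (hB ⟨τ, h1, rfl⟩)⟩, h1⟩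
  have hFc : ContinuousOn (fun p : ℝ × ℝ => Real.exp (-(M+1) * p.2) * f p.1 p.2) R :=
    ContinuousOn.mul (by fun_prop) hc
  obtain ⟨⟨y, τ⟩, ⟨hp1, hp2⟩, hmin⟩ := hcomp.exists_isMinOn ⟨(x, t), ht, hx⟩ hFc
  simp only at hp1 hp2
  have hmin' : ∀ y' τ', (y', τ') ∈ R →
      Real.exp (-(M+1) * τ) * f y τ ≤ Real.exp (-(M+1) * τ') * f y' τ' := fun y' τ' h => hmin h
  have hn : f y τ < 0 := by
    have h1 := hmin' x t ⟨ht, hx⟩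
    have h2 := Real.exp_pos (-(M+1) * τ)
    have h3 := Real.exp_pos (-(M+1) * t)
    by_contra h4
    push Not at h4
    nlinarith [mul_nonneg h2.le h4, mul_neg_of_pos_of_neg h3 hneg]
  have ht1 : t1 < τ := by
    rcases hp1.1.lt_or_eq with h | h
    · exact h
    · subst h; exact absurd (h0 y hp2) (not_le.2 hn)
  have hy1 : l τ < y := by
    rcases hp2.1.lt_or_eq with h | h
    · exact h
    · subst h; exact absurd (hL τ hp1 hp2.2) (not_le.2 hn)
  have hy2 : y < r τ := by
    rcases hp2.2.lt_or_eq with h | h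
    · exact h
    · rw [h] at hn; exact absurd (hR τ hp1 (h ▸ hp2.1)) (not_le.2 hn)
  refine core_lemma (hS τ ⟨ht1, hp1.2⟩ y ⟨hy1, hy2⟩) hn ?_ ?_
  · filter_upwards [Ioo_mem_nhds hy1 hy2] with z hz
    have := hmin' z τ ⟨hp1, hz.1.le, hz.2.le⟩
    exact le_of_mul_le_mul_left this (Real.exp_pos _)
  · have hnb : 𝓝[<] τ ≤ 𝓝[Icc t1 t2] τ := by
      rw [← nhdsWithin_Ioo_eq_nhdsLT ht1]
      exact nhdsWithin_mono _ (fun z hz => ⟨hz.1.le, hz.2.le.trans hp1.2⟩)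
    have e1 := ((hl τ hp1).mono_left hnb).eventually (gt_mem_nhds hy1)
    have e2 := ((hr τ hp1).mono_left hnb).eventually (lt_mem_nhds hy2)
    have e3 : ∀ᶠ z in 𝓝[<] τ, z ∈ Icc t1 t2 := hnb self_mem_nhdsWithin
    filter_upwards [e1, e2, e3] with z h1 h2 h3
    exact hmin' y z ⟨h3, h1.le, h2.le⟩

set_option maxHeartbeats 1000000 in
theorem strong_pos {a b c : ℝ → ℝ → ℝ} {M : ℝ} {f : ℝ → ℝ → ℝ} {A B t1 t2 : ℝ}
    (ht : t1 < t2)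
    (hc : ContinuousOn (fun p : ℝ × ℝ => f p.1 p.2) (Icc A B ×ˢ Icc t1 t2))
    (hS : ∀ t ∈ Ioc t1 t2, ∀ x ∈ Ioo A B, SupS a b c M f x t)
    (hnn : ∀ t ∈ Icc t1 t2, ∀ x ∈ Icc A B, 0 ≤ f x t)
    {y : ℝ} (hy : y ∈ Ioo A B) (hfy : 0 < f y t1) {x0 : ℝ} (hx0 : x0 ∈ Ioo A B) :
    0 < f x0 t2 := by
  have hMpos : 0 < M := (hS t2 ⟨ht, le_rfl⟩ x0 hx0).1.1
  -- radius
  have hcy : ContinuousAt (fun z => f z t1) y := by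
    have h1 : ContinuousOn (fun z => f z t1) (Icc A B) :=
      hc.comp (f := fun z => (z, t1)) (by fun_prop) (fun z hz => ⟨hz, le_rfl, ht.le⟩)
    exact h1.continuousAt (Icc_mem_nhds hy.1 hy.2)
  obtain ⟨ρ1, hρ1, hb1⟩ := Metric.eventually_nhds_iff.1
    (hcy.eventually (lt_mem_nhds (show f y t1 / 2 < f y t1 by linarith)))
  obtain ⟨ρ, hρ, hr1, hr2, hr3, hr4, hr5⟩ : ∃ ρ > 0, ρ < ρ1 ∧ ρ < y - A ∧ ρ < B - y ∧
      ρ < x0 - A ∧ ρ < B - x0 := by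
    have h1 : 0 < min ρ1 (min (min (y - A) (B - y)) (min (x0 - A) (B - x0))) := by
      simp only [lt_min_iff]
      exact ⟨hρ1, ⟨by linarith [hy.1], by linarith [hy.2]⟩, by linarith [hx0.1], by linarith [hx0.2]⟩
    obtain ⟨ρ, h2, h3⟩ := exists_between h1
    simp only [lt_min_iff] at h3
    exact ⟨ρ, h2, h3.1, h3.2.1.1, h3.2.1.2, h3.2.2.1, h3.2.2.2⟩
  obtain ⟨σ, hσ⟩ : ∃ σ, σ = (x0 - y) / (t2 - t1) := ⟨_, rfl⟩
  have hσ2 : y + σ * (t2 - t1) = x0 := by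
    rw [hσ, div_mul_cancel₀ _ (by linarith)]; ring
  obtain ⟨C, hC⟩ : ∃ C, C = 12 * M + 4 * M * ρ + 4 * |σ| * ρ := ⟨_, rfl⟩
  obtain ⟨A', hA'⟩ : ∃ A', A' = 8 * ρ ^ 2 * M⁻¹ := ⟨_, rfl⟩
  have hA'pos : 0 < A' := by rw [hA']; positivity
  obtain ⟨Λ, hΛ⟩ : ∃ Λ, Λ = M + C ^ 2 / (4 * A') := ⟨_, rfl⟩
  let γ : ℝ → ℝ := fun t => y + σ * (t - t1)
  let v : ℝ → ℝ → ℝ := fun x t =>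
    -(Real.exp (-Λ * (t - t1)) * (ρ ^ 2 - (x - (y + σ * (t - t1))) ^ 2) ^ 2)
  obtain ⟨ε, hε⟩ : ∃ ε, ε = f y t1 / 2 / ρ ^ 4 := ⟨_, rfl⟩
  have hεpos : 0 < ε := by rw [hε]; positivity
  have htube : ∀ t ∈ Icc t1 t2, ∀ x ∈ Icc (γ t - ρ) (γ t + ρ), x ∈ Ioo A B := by
    intro t htt x hx
    obtain ⟨θ, hθ⟩ : ∃ θ, θ = (t - t1) / (t2 - t1) := ⟨_, rfl⟩
    have hθ0 : 0 ≤ θ := by rw [hθ]; exact div_nonneg (by linarith [htt.1]) (by linarith)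
    have hθ1 : θ ≤ 1 := by rw [hθ, div_le_one (by linarith)]; linarith [htt.2]
    have hγ : γ t = y + θ * (x0 - y) := by
      simp only [γ, hσ, hθ]; ring
    rw [hγ] at hx
    have e1 : (1 - θ) * y + θ * x0 ∈ Ioo (A + ρ) (B - ρ) :=
      (convex_Ioo (A + ρ) (B - ρ)) ⟨by linarith, by linarith⟩ ⟨by linarith, by linarith⟩
        (by linarith) hθ0 (by ring)
    constructor
    · linarith [hx.1, e1.1]
    · linarith [hx.2, e1.2]
  have hSv : ∀ t ∈ Ioc t1 t2, ∀ x ∈ Ioo (γ t - ρ) (γ t + ρ), SupS a b c M v x t := by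
    intro t htt x hx
    have hin := htube t ⟨htt.1.le, htt.2⟩ x ⟨hx.1.le, hx.2.le⟩
    have hb := (hS t htt x hin).1
    refine ⟨hb, fun z => -(Real.exp (-Λ * (t - t1)) *
        (-4 * (ρ ^ 2 - (z - (y + σ * (t - t1))) ^ 2) * (z - (y + σ * (t - t1))))),
      -(Real.exp (-Λ * (t - t1)) * (-Λ * (ρ ^ 2 - (x - (y + σ * (t - t1))) ^ 2) ^ 2 +
        4 * (ρ ^ 2 - (x - (y + σ * (t - t1))) ^ 2) * (x - (y + σ * (t - t1))) * σ)),
      -(Real.exp (-Λ * (t - t1)) * (8 * (x - (y + σ * (t - t1))) ^ 2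
        - 4 * (ρ ^ 2 - (x - (y + σ * (t - t1))) ^ 2))), ?_, ?_, ?_, ?_⟩
    · refine Eventually.of_forall fun z => ?_
      have h1 : HasDerivAt (fun z : ℝ => z - (y + σ * (t - t1))) 1 z :=
        (hasDerivAt_id z).sub_const _
      have h2 := ((((h1.pow 2).const_sub (ρ ^ 2)).pow 2).const_mul (Real.exp (-Λ * (t - t1)))).neg
      refine h2.congr_deriv ?_
      push_cast; simp; ring
    · have h1 : HasDerivAt (fun z : ℝ => z - (y + σ * (t - t1))) 1 x :=
        (hasDerivAt_id x).sub_const _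
      have h2 := (((((h1.pow 2).const_sub (ρ ^ 2)).const_mul (-4)).mul h1).const_mul
        (Real.exp (-Λ * (t - t1)))).neg
      refine h2.congr_deriv ?_
      push_cast; simp; ring
    · have h0 : HasDerivAt (fun τ : ℝ => τ - t1) 1 t := (hasDerivAt_id t).sub_const _
      have h1 : HasDerivAt (fun τ : ℝ => x - (y + σ * (τ - t1))) (-(σ * 1)) t :=
        ((h0.const_mul σ).const_add y).const_sub x
      have h2 := (((h0.const_mul (-Λ)).exp).mul (((h1.pow 2).const_sub (ρ ^ 2)).pow 2)).neg
      refine h2.congr_deriv ?_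
      push_cast; simp; ring
    · obtain ⟨w, hw⟩ : ∃ w, w = x - (y + σ * (t - t1)) := ⟨_, rfl⟩
      simp only [v]
      rw [← hw]
      have hE := Real.exp_pos (-Λ * (t - t1))
      have hwabs : |w| ≤ ρ := by
        rw [abs_le, hw]; simp only [γ, mem_Ioo] at hx; constructor <;> linarith
      obtain ⟨q, hq⟩ : ∃ q, q = ρ ^ 2 - w ^ 2 := ⟨_, rfl⟩
      have hq0 : 0 ≤ q := by
        rw [hq]; nlinarith [sq_abs w, abs_nonneg w]
      have hw2 : w ^ 2 = ρ ^ 2 - q := by linarith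
      rw [← hq]
      obtain ⟨-, ha1, ha2, hb1, hc1⟩ := hb
      suffices h : -Λ * q ^ 2 + 4 * q * w * σ ≤
          a x t * (8 * w ^ 2 - 4 * q) + b x t * (-4 * q * w) + c x t * q ^ 2 by
        have := mul_le_mul_of_nonneg_left h hE.le
        linarith
      rw [hw2]
      have k1 : w * σ ≤ |σ| * ρ := by
        calc w * σ ≤ |w * σ| := le_abs_self _
          _ = |σ| * |w| := by rw [abs_mul, mul_comm]
          _ ≤ |σ| * ρ := by gcongr
      have k2 : b x t * w ≤ M * ρ := by
        calc b x t * w ≤ |b x t * w| := le_abs_self _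
          _ = |b x t| * |w| := by rw [abs_mul]
          _ ≤ M * ρ := by gcongr
      have k3 : -M * q ^ 2 ≤ c x t * q ^ 2 := by
        have := (abs_le.1 hc1).1
        gcongr
      have k4 : A' ≤ a x t * (8 * ρ ^ 2) := by
        rw [hA']; nlinarith [sq_nonneg ρ]
      have k5 : 0 ≤ A' - C * q + C ^ 2 / (4 * A') * q ^ 2 := by
        have : A' - C * q + C ^ 2 / (4 * A') * q ^ 2 = (2 * A' - C * q) ^ 2 / (4 * A') := by
          field_simp; ring
        rw [this]; positivity
      have k6 : Λ * q ^ 2 = M * q ^ 2 + C ^ 2 / (4 * A') * q ^ 2 := by rw [hΛ]; ring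
      have k1' := mul_le_mul_of_nonneg_left k1 hq0
      have k2' := mul_le_mul_of_nonneg_left k2 hq0
      have k7 := mul_le_mul_of_nonneg_left ha2 hq0
      have k8 : C * q = 12 * (q * M) + 4 * (q * (M * ρ)) + 4 * (q * (|σ| * ρ)) := by rw [hC]; ring
      linarith
  have hW := weak_max (a := a) (b := b) (c := c) (M := M)
    (f := fun x t => f x t + ε * v x t) (l := fun t => γ t - ρ) (r := fun t => γ t + ρ)
    (t1 := t1) (t2 := t2) (by simp only [γ]; fun_prop) (by simp only [γ]; fun_prop) ?_ ?_ ?_ ?_ ?_ t2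
    ⟨ht.le, le_rfl⟩ x0 ?_
  · simp only [v, hσ2] at hW
    have := Real.exp_pos (-Λ * (t2 - t1))
    have h2 : 0 < ε * (Real.exp (-Λ * (t2 - t1)) * (ρ ^ 2 - (x0 - x0) ^ 2) ^ 2) := by
      have : ρ ^ 2 - (x0 - x0) ^ 2 = ρ ^ 2 := by ring
      rw [this]; positivity
    linarith
  · refine ContinuousOn.add (hc.mono ?_) (by simp only [v]; fun_prop)
    rintro ⟨z, τ⟩ ⟨h1, h2⟩
    have := htube τ h1 z h2
    exact ⟨⟨this.1.le, this.2.le⟩, h1⟩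
  · intro t htt x hx
    exact (hS t htt x (htube t ⟨htt.1.le, htt.2⟩ x ⟨hx.1.le, hx.2.le⟩)).add
      ((hSv t htt x hx).smul hεpos.le)
  · intro x hx
    simp only [γ, sub_self, mul_zero, add_zero, mem_Icc] at hx
    have h1 : f y t1 / 2 < f x t1 := hb1 (by
      rw [Real.dist_eq, abs_lt]; constructor <;> linarith)
    simp only [v, sub_self, mul_zero, add_zero, Real.exp_zero, one_mul]
    have h2 : 0 ≤ ρ ^ 2 - (x - y) ^ 2 := by nlinarith
    have h3 : (ρ ^ 2 - (x - y) ^ 2) ^ 2 ≤ (ρ ^ 2) ^ 2 := by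
      gcongr; nlinarith [sq_nonneg (x - y)]
    have h4 : ε * (ρ ^ 2) ^ 2 = f y t1 / 2 := by rw [hε]; field_simp
    nlinarith
  · intro t htt _
    have := hnn t htt (γ t - ρ) (Ioo_subset_Icc_self (htube t htt _ ⟨le_rfl, by linarith⟩))
    have e : v (γ t - ρ) t = 0 := by simp only [v, γ]; ring
    simp only [e]; linarith
  · intro t htt _
    have := hnn t htt (γ t + ρ) (Ioo_subset_Icc_self (htube t htt _ ⟨by linarith, le_rfl⟩))
    have e : v (γ t + ρ) t = 0 := by simp only [v, γ]; ring
    simp only [e]; linarith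
  · simp only [γ, hσ2]; constructor <;> linarith

theorem strong_pos' {a b c : ℝ → ℝ → ℝ} {M : ℝ} {f : ℝ → ℝ → ℝ} {A B t1 t2 : ℝ}
    (ht : t1 < t2)
    (hc : ContinuousOn (fun p : ℝ × ℝ => f p.1 p.2) (Icc A B ×ˢ Icc t1 t2))
    (hS : ∀ t ∈ Ioc t1 t2, ∀ x ∈ Ioo A B, SupS a b c M f x t)
    (hnn : ∀ t ∈ Icc t1 t2, ∀ x ∈ Icc A B, 0 ≤ f x t)
    {y : ℝ} (hy : y ∈ Icc A B) (hfy : 0 < f y t1) {x0 : ℝ} (hx0 : x0 ∈ Ioo A B) :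
    0 < f x0 t2 := by
  have h1 : ContinuousOn (fun z => f z t1) (Icc A B) :=
    hc.comp (f := fun z => (z, t1)) (by fun_prop) (fun z hz => ⟨hz, le_rfl, ht.le⟩)
  have h2 := (h1 y hy).eventually (lt_mem_nhds hfy)
  have hAB : A ≠ B := (hx0.1.trans hx0.2).ne
  have hcl : y ∈ closure (Ioo A B) := by rw [closure_Ioo hAB]; exact hy
  have hne : (𝓝[Ioo A B] y).NeBot := mem_closure_iff_nhdsWithin_neBot.1 hcl
  have h3 : ∀ᶠ z in 𝓝[Ioo A B] y, 0 < f z t1 := nhdsWithin_mono _ Ioo_subset_Icc_self h2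
  obtain ⟨z, hz1, hz2⟩ := (h3.and self_mem_nhdsWithin).exists
  exact strong_pos ht hc hS hnn hz2 hz1 hx0

theorem lemA {a b c : ℝ → ℝ → ℝ} {M : ℝ} {P N : ℝ → ℝ → ℝ} {l r t1 t2 : ℝ}
    (hcP : ContinuousOn (fun p : ℝ × ℝ => P p.1 p.2) (Icc l r ×ˢ Icc t1 t2))
    (hcN : ContinuousOn (fun p : ℝ × ℝ => N p.1 p.2) (Icc l r ×ˢ Icc t1 t2))
    (hSP : ∀ t ∈ Ioc t1 t2, ∀ x ∈ Ioo l r, SupS a b c M (fun x t => -P x t) x t)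
    (hSN : ∀ t ∈ Ioc t1 t2, ∀ x ∈ Ioo l r, SupS a b c M N x t)
    (hPN : ∀ t ∈ Icc t1 t2, ∀ x ∈ Icc l r, P x t ≤ N x t)
    (hPl : ∀ t ∈ Icc t1 t2, P l t ≤ 0) (hNr : ∀ t ∈ Icc t1 t2, 0 ≤ N r t)
    (h0 : ∀ x ∈ Icc l r, ∀ y ∈ Icc l r, x ≤ y → 0 < P x t1 → 0 ≤ N y t1) :
    ∀ t ∈ Icc t1 t2, ∀ x ∈ Icc l r, ∀ y ∈ Icc l r, x ≤ y → 0 < P x t → 0 ≤ N y t := by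
  by_contra hcon
  push Not at hcon
  obtain ⟨t', ht', x', hx', y', hy', hxy', hP', hN'⟩ := hcon
  let B : Set (ℝ × ℝ) := {p | p ∈ Icc l r ×ˢ Icc t1 t2 ∧ 0 < P p.1 p.2 ∧
    ∃ y ∈ Icc l r, p.1 ≤ y ∧ N y p.2 < 0}
  have hrect : IsCompact (Icc l r ×ˢ Icc t1 t2) := isCompact_Icc.prod isCompact_Icc
  have hBsub : B ⊆ Icc l r ×ˢ Icc t1 t2 := fun p hp => hp.1
  have hKsub : closure B ⊆ Icc l r ×ˢ Icc t1 t2 := closure_minimal hBsub hrect.isClosed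
  have hK : IsCompact (closure B) := hrect.of_isClosed_subset isClosed_closure hKsub
  have hFc : ContinuousOn (fun p : ℝ × ℝ => Real.exp (-(M+1) * p.2) * P p.1 p.2) (closure B) :=
    ContinuousOn.mul (by fun_prop) (hcP.mono hKsub)
  have hp0 : (x', t') ∈ B := ⟨⟨hx', ht'⟩, hP', y', hy', hxy', hN'⟩
  obtain ⟨⟨xs, ts⟩, hpK, hmax⟩ := hK.exists_isMaxOn ⟨_, subset_closure hp0⟩ hFc
  have hmax' : ∀ x t, (x, t) ∈ closure B →
      Real.exp (-(M+1) * t) * P x t ≤ Real.exp (-(M+1) * ts) * P xs ts := fun x t h => hmax h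
  obtain ⟨hxs, hts⟩ := hKsub hpK
  simp only at hxs hts
  have hpos : 0 < P xs ts := by
    have h1 := hmax' x' t' (subset_closure hp0)
    have h2 := mul_pos (Real.exp_pos (-(M+1) * t')) hP'
    exact pos_of_mul_pos_right (h2.trans_le h1) (Real.exp_pos _).le
  obtain ⟨δ, hδ, hball⟩ : ∃ δ > 0, ∀ x ∈ Icc l r, ∀ t ∈ Icc t1 t2, |x - xs| < δ → |t - ts| < δ →
      0 < P x t := by
    have := (hcP (xs, ts) ⟨hxs, hts⟩).eventually (lt_mem_nhds hpos)
    rw [Metric.nhdsWithin_basis_ball.eventually_iff] at this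
    obtain ⟨δ, hδ, h⟩ := this
    refine ⟨δ, hδ, fun x hx t ht h1 h2 => h (x := (x, t)) ⟨?_, hx, ht⟩⟩
    rw [Metric.mem_ball, Prod.dist_eq, Real.dist_eq, Real.dist_eq]
    exact max_lt h1 h2
  -- propagation
  have hprop : ∀ x ∈ Icc l r, ∀ t ∈ Icc t1 t2, |x - xs| < δ → |t - ts| < δ →
      ∀ xn tn, (xn, tn) ∈ B → |xn - xs| < δ → |tn - ts| < δ → t < tn → (x, t) ∈ B := by
    intro x hx t ht hxδ htδ xn tn hn hxn htn htt
    by_contra hnB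
    have hQ : ∀ y ∈ Icc l r, x ≤ y → 0 ≤ N y t := by
      intro y hy hxy
      by_contra hneg
      push Not at hneg
      exact hnB ⟨⟨hx, ht⟩, hball x hx t ht hxδ htδ, y, hy, hxy, hneg⟩
    obtain ⟨⟨hxnI, htnI⟩, -, y, hy, hxy, hneg⟩ := hn
    simp only at hxnI htnI hxy hneg
    obtain ⟨σ, hσ⟩ : ∃ σ, σ = (xn - x) / (tn - t) := ⟨_, rfl⟩
    have hσ2 : x + σ * (tn - t) = xn := by
      rw [hσ, div_mul_cancel₀ _ (by linarith)]; ring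
    have hline : ∀ τ ∈ Icc t tn, x + σ * (τ - t) ∈ Icc l r ∧ |x + σ * (τ - t) - xs| < δ := by
      intro τ hτ
      obtain ⟨θ, hθ⟩ : ∃ θ, θ = (τ - t) / (tn - t) := ⟨_, rfl⟩
      have hθ0 : 0 ≤ θ := by rw [hθ]; exact div_nonneg (by linarith [hτ.1]) (by linarith)
      have hθ1 : θ ≤ 1 := by rw [hθ, div_le_one (by linarith)]; linarith [hτ.2]
      have hγ : x + σ * (τ - t) = (1 - θ) * x + θ * xn := by
        simp only [hσ, hθ]; ring
      rw [hγ]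
      have e1 : (1 - θ) * x + θ * xn ∈ Icc l r :=
        (convex_Icc l r) hx hxnI (by linarith) hθ0 (by ring)
      have e2 : (1 - θ) * x + θ * xn ∈ Metric.ball xs δ :=
        (convex_ball xs δ) (by rwa [Metric.mem_ball, Real.dist_eq])
          (by rwa [Metric.mem_ball, Real.dist_eq]) (by linarith) hθ0 (by ring)
      rw [Metric.mem_ball, Real.dist_eq] at e2
      exact ⟨e1, e2⟩
    have hsubt : ∀ τ ∈ Icc t tn, τ ∈ Icc t1 t2 := fun τ hτ =>
      ⟨ht.1.trans hτ.1, hτ.2.trans htnI.2⟩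
    have hW := weak_max (a := a) (b := b) (c := c) (M := M) (f := N)
      (l := fun τ => x + σ * (τ - t)) (r := fun _ => r) (t1 := t) (t2 := tn)
      (by fun_prop) (by fun_prop) ?_ ?_ ?_ ?_ ?_ tn ⟨htt.le, le_rfl⟩ y ?_
    · linarith
    · refine hcN.mono ?_
      rintro ⟨z, τ⟩ ⟨h1, h2⟩
      exact ⟨⟨(hline τ h1).1.1.trans h2.1, h2.2⟩, hsubt τ h1⟩
    · intro τ hτ z hz
      have h1 : τ ∈ Icc t tn := ⟨hτ.1.le, hτ.2⟩
      exact hSN τ ⟨ht.1.trans_lt hτ.1, (hsubt τ h1).2⟩ z ⟨(hline τ h1).1.1.trans_lt hz.1, hz.2⟩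
    · intro z hz
      simp only [sub_self, mul_zero, add_zero] at hz
      exact hQ z ⟨hx.1.trans hz.1, hz.2⟩ hz.1
    · intro τ hτ _
      have h1 := hline τ hτ
      have h2 : |τ - ts| < δ := by
        rw [abs_lt] at htδ htn ⊢
        constructor <;> linarith [hτ.1, hτ.2]
      exact (hball _ h1.1 τ (hsubt τ hτ) h1.2 h2).le.trans (hPN τ (hsubt τ hτ) _ h1.1)
    · intro τ hτ _
      exact hNr τ (hsubt τ hτ)
    · simp only [hσ2]; exact ⟨hxy, hy.2⟩
  have hbot : ∀ x, (x, t1) ∉ B := by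
    rintro x ⟨⟨hx, -⟩, h1, y, hy, hxy, hneg⟩
    exact absurd (h0 x hx y hy hxy h1) (not_le.2 hneg)
  have hnear : ∀ η > 0, ∃ xn tn, (xn, tn) ∈ B ∧ |xn - xs| < η ∧ |tn - ts| < η := by
    intro η hη
    obtain ⟨⟨xn, tn⟩, h1, h2⟩ := Metric.mem_closure_iff.1 hpK η hη
    rw [dist_comm, Prod.dist_eq, max_lt_iff, Real.dist_eq, Real.dist_eq] at h2
    exact ⟨xn, tn, h1, h2⟩
  have hts1 : t1 < ts := by
    rcases hts.1.lt_or_eq with h | h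
    · exact h
    · exfalso
      obtain ⟨xn, tn, h1, h2, h3⟩ := hnear δ hδ
      rcases h1.1.2.1.lt_or_eq with h4 | h4
      · simp only at h4
        exact hbot xs (hprop xs hxs t1 ⟨le_rfl, hts.1.trans hts.2⟩ (by simpa using hδ)
          (by rw [h]; simpa using hδ) xn tn h1 h2 h3 h4)
      · simp only at h4
        rw [← h4] at h1
        exact hbot xn h1
  have hback : ∀ x ∈ Icc l r, ∀ t ∈ Icc t1 t2, |x - xs| < δ → |t - ts| < δ → t < ts → (x, t) ∈ B := by
    intro x hx t ht h1 h2 h3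
    obtain ⟨xn, tn, k1, k2, k3⟩ := hnear (min δ (ts - t)) (lt_min hδ (by linarith))
    rw [lt_min_iff] at k2 k3
    refine hprop x hx t ht h1 h2 xn tn k1 k2.1 k3.1 ?_
    have := (abs_lt.1 k3.2).1
    linarith
  have hearly : ∀ᶠ t in 𝓝[<] ts, t ∈ Icc t1 t2 ∧ |t - ts| < δ ∧ t < ts := by
    have h1 : ∀ᶠ t in 𝓝[<] ts, t ∈ Ioo (max t1 (ts - δ)) ts :=
      Ioo_mem_nhdsLT (max_lt hts1 (by linarith))
    filter_upwards [h1] with t ht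
    have := max_lt_iff.1 ht.1
    exact ⟨⟨this.1.le, ht.2.le.trans hts.2⟩, by rw [abs_lt]; constructor <;> linarith [ht.2], ht.2⟩
  have hxr : xs < r := by
    rcases hxs.2.lt_or_eq with h | h
    · exact h
    · exfalso
      obtain ⟨t, h1, h2, h3⟩ := hearly.exists
      obtain ⟨-, -, y, hy, hxy, hneg⟩ := hback xs hxs t h1 (by simpa using hδ) h2 h3
      simp only at hxy hneg
      have : y = r := le_antisymm hy.2 (h ▸ hxy)
      rw [this] at hneg
      exact absurd (hNr t h1) (not_le.2 hneg)
  have hxl : l < xs := by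
    rcases hxs.1.lt_or_eq with h | h
    · exact h
    · rw [← h] at hpos
      exact absurd (hPl ts hts) (not_le.2 hpos)
  refine core_lemma (hSP ts ⟨hts1, hts.2⟩ xs ⟨hxl, hxr⟩) (by simpa using hpos) ?_ ?_
  · filter_upwards [Ioo_mem_nhds hxl hxr, Metric.ball_mem_nhds xs hδ] with z hz hz2
    rw [Metric.mem_ball, Real.dist_eq] at hz2
    have hmem : (z, ts) ∈ closure B := by
      have ht : Tendsto (fun t : ℝ => (z, t)) (𝓝[<] ts) (𝓝 (z, ts)) :=
        (Continuous.tendsto (by fun_prop) ts).mono_left nhdsWithin_le_nhds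
      refine mem_closure_of_tendsto ht ?_
      filter_upwards [hearly] with t h
      exact hback z ⟨hz.1.le, hz.2.le⟩ t h.1 hz2 h.2.1 h.2.2
    have := le_of_mul_le_mul_left (hmax' z ts hmem) (Real.exp_pos _)
    simpa using this
  · filter_upwards [hearly] with t h
    have := hmax' xs t (subset_closure (hback xs hxs t h.1 (by simpa using hδ) h.2.1 h.2.2))
    linarith

theorem left_time {g : ℝ → ℝ} {t1 t2 t : ℝ} (hg : ContinuousOn g (Icc t1 t2)) (ht : t ∈ Ioc t1 t2)
    (hp : 0 < g t) : ∃ t' ∈ Ico t1 t, ∀ τ ∈ Icc t' t, 0 < g τ := by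
  have h1 := (hg t ⟨ht.1.le, ht.2⟩).eventually (lt_mem_nhds hp)
  rw [Metric.nhdsWithin_basis_ball.eventually_iff] at h1
  obtain ⟨δ, hδ, h⟩ := h1
  refine ⟨max t1 (t - δ / 2), ⟨le_max_left _ _, max_lt ht.1 (by linarith)⟩, fun τ hτ => ?_⟩
  have := max_le_iff.1 hτ.1
  refine h ⟨?_, this.1, hτ.2.trans ht.2⟩
  rw [Metric.mem_ball, Real.dist_eq, abs_lt]
  constructor <;> linarith [hτ.2]

theorem bump_exists {α β : ℝ} (h : α < β) : ∃ (φ φ' φ'' : ℝ → ℝ) (D : ℝ),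
    (∀ x, HasDerivAt φ (φ' x) x) ∧ (∀ x, HasDerivAt φ' (φ'' x) x) ∧ (∀ x, |φ x| ≤ 1) ∧
    (∀ x, |φ' x| ≤ D) ∧ (∀ x, |φ'' x| ≤ D) ∧ (∀ x, x ∉ Icc α β → φ x = 0) ∧
    ∃ c1 ∈ Icc α β, ∃ c2 ∈ Icc α β, c1 ≤ c2 ∧ φ c1 = -1 ∧ φ c2 = 1 := by
  let f1 : ContDiffBump (α + (β - α) / 4) := ⟨(β - α) / 16, (β - α) / 8, by linarith, by linarith⟩
  let f2 : ContDiffBump (β - (β - α) / 4) := ⟨(β - α) / 16, (β - α) / 8, by linarith, by linarith⟩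
  let φ : ℝ → ℝ := fun x => f2 x - f1 x
  have hsm : ContDiff ℝ 2 φ := f2.contDiff.sub f1.contDiff
  have hcs : HasCompactSupport φ := f2.hasCompactSupport.sub f1.hasCompactSupport
  have h1 : ContDiff ℝ 1 (deriv φ) := by
    have : ContDiff ℝ (1 + 1) φ := by norm_num; exact hsm
    exact (contDiff_succ_iff_deriv.1 this).2.2
  have h2 : Continuous (deriv (deriv φ)) := h1.continuous_deriv le_rfl
  obtain ⟨D1, hD1⟩ := hcs.deriv.exists_bound_of_continuous h1.continuous
  obtain ⟨D2, hD2⟩ := hcs.deriv.deriv.exists_bound_of_continuous h2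
  refine ⟨φ, deriv φ, deriv (deriv φ), max D1 D2, ?_, ?_, ?_, ?_, ?_, ?_, ?_⟩
  · exact fun x => ((hsm.differentiable (by norm_num)) x).hasDerivAt
  · exact fun x => ((h1.differentiable (by norm_num)) x).hasDerivAt
  · intro x
    have := f1.nonneg (x := x); have := f1.le_one (x := x)
    have := f2.nonneg (x := x); have := f2.le_one (x := x)
    simp only [φ, abs_le]; constructor <;> linarith
  · exact fun x => (hD1 x).trans (le_max_left _ _)
  · exact fun x => (hD2 x).trans (le_max_right _ _)
  · intro x hx
    have e1 : f1 x = 0 := f1.zero_of_le_dist (by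
      by_contra hlt
      push Not at hlt
      rw [Real.dist_eq, abs_lt] at hlt
      simp only [f1] at hlt
      exact hx ⟨by linarith [hlt.1], by linarith [hlt.2]⟩)
    have e2 : f2 x = 0 := f2.zero_of_le_dist (by
      by_contra hlt
      push Not at hlt
      rw [Real.dist_eq, abs_lt] at hlt
      simp only [f2] at hlt
      exact hx ⟨by linarith [hlt.1], by linarith [hlt.2]⟩)
    simp [φ, e1, e2]
  · refine ⟨α + (β - α) / 4, ⟨by linarith, by linarith⟩, β - (β - α) / 4,
      ⟨by linarith, by linarith⟩, by linarith, ?_, ?_⟩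
    · have e1 : f1 (α + (β - α) / 4) = 1 := f1.one_of_mem_closedBall (by simp [f1]; linarith)
      have e2 : f2 (α + (β - α) / 4) = 0 := f2.zero_of_le_dist (by
        rw [Real.dist_eq, abs_of_nonpos (by linarith)]; simp only [f2]; linarith)
      simp [φ, e1, e2]
    · have e1 : f2 (β - (β - α) / 4) = 1 := f2.one_of_mem_closedBall (by simp [f2]; linarith)
      have e2 : f1 (β - (β - α) / 4) = 0 := f1.zero_of_le_dist (by
        rw [Real.dist_eq, abs_of_nonneg (by linarith)]; simp only [f1]; linarith)
      simp [φ, e1, e2]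

theorem barrier_sup {a b c : ℝ → ℝ → ℝ} {M : ℝ} {f : ℝ → ℝ → ℝ} {x t s K D : ℝ}
    {ψ ψ' ψ'' : ℝ → ℝ} (hf : SupS a b c M f x t)
    (h1 : ∀ x, HasDerivAt ψ (ψ' x) x) (h2 : ∀ x, HasDerivAt ψ' (ψ'' x) x) (h3 : ∀ x, |ψ x| ≤ 1)
    (h4 : ∀ x, |ψ' x| ≤ D) (h5 : ∀ x, |ψ'' x| ≤ D) (hK : K = 2 * M * (2 * D + 1))
    (hst : s ≤ t) (hM : M * (t - s) ≤ 1 / 2) :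
    SupS a b c M (fun x t => ψ x + K * (t - s)) x t := by
  have hb := hf.1
  refine ⟨hb, ψ', K * 1, ψ'' x, ?_, h2 x, ?_, ?_⟩
  · exact Eventually.of_forall fun z => (h1 z).add_const _
  · exact (((hasDerivAt_id t).sub_const s).const_mul K).const_add _
  · obtain ⟨hM0, ha1, ha2, hb1, hc1⟩ := hb
    have hD : 0 ≤ D := (abs_nonneg _).trans (h4 x)
    have ha : |a x t| ≤ M := by
      rw [abs_of_nonneg ((inv_pos.2 hM0).le.trans ha1)]; exact ha2
    have key : ∀ p q P Q : ℝ, |p| ≤ P → |q| ≤ Q → p * q ≤ P * Q := by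
      intro p q P Q hp hq
      calc p * q ≤ |p * q| := le_abs_self _
        _ = |p| * |q| := abs_mul _ _
        _ ≤ P * Q := by
          have := (abs_nonneg p).trans hp
          gcongr
    have k1 := key _ _ _ _ ha (h5 x)
    have k2 := key _ _ _ _ hb1 (h4 x)
    have k3 := key _ _ _ _ hc1 (h3 x)
    have hK0 : 0 ≤ K := by rw [hK]; positivity
    have k4 : c x t * (K * (t - s)) ≤ K / 2 := by
      have e1 : c x t * (K * (t - s)) ≤ M * (K * (t - s)) := by
        have : 0 ≤ K * (t - s) := mul_nonneg hK0 (by linarith)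
        have := (abs_le.1 hc1).2
        gcongr
      nlinarith
    have : K / 2 = M * D + M * D + M * 1 := by rw [hK]; ring
    simp only
    linarith

theorem slice_cont {u : ℝ → ℝ → ℝ} {l r t1 t2 t : ℝ}
    (hc : ContinuousOn (fun p : ℝ × ℝ => u p.1 p.2) (Icc l r ×ˢ Icc t1 t2)) (ht : t ∈ Icc t1 t2) :
    ContinuousOn (fun x => u x t) (Icc l r) :=
  hc.comp (f := fun z => (z, t)) (by fun_prop) (fun z hz => ⟨hz, ht⟩)

theorem slice_cont' {u : ℝ → ℝ → ℝ} {l r t1 t2 x : ℝ}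
    (hc : ContinuousOn (fun p : ℝ × ℝ => u p.1 p.2) (Icc l r ×ˢ Icc t1 t2)) (hx : x ∈ Icc l r) :
    ContinuousOn (fun t => u x t) (Icc t1 t2) :=
  hc.comp (f := fun z => (x, z)) (by fun_prop) (fun z hz => ⟨hx, hz⟩)

theorem cpt_lower {g : ℝ → ℝ} {p q : ℝ} (hg : ContinuousOn g (Icc p q)) (h : ∀ x ∈ Icc p q, 0 < g x) :
    ∃ d > 0, ∀ x ∈ Icc p q, d ≤ g x := by
  rcases (Icc p q).eq_empty_or_nonempty with he | hne
  · exact ⟨1, one_pos, fun x hx => by rw [he] at hx; exact hx.elim⟩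
  · obtain ⟨z, hz, hm⟩ := isCompact_Icc.exists_isMinOn hne hg
    exact ⟨g z, h z hz, fun x hx => hm hx⟩

theorem flat_core {a b c : ℝ → ℝ → ℝ} {M : ℝ} {u : ℝ → ℝ → ℝ} {l r s t : ℝ}
    (hst : s < t)
    (hc : ContinuousOn (fun p : ℝ × ℝ => u p.1 p.2) (Icc l r ×ˢ Icc s t))
    (hS : ∀ τ ∈ Ioc s t, ∀ x ∈ Ioo l r, SupS a b c M u x τ)
    (hS' : ∀ τ ∈ Ioc s t, ∀ x ∈ Ioo l r, SupS a b c M (fun x t => -u x t) x τ)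
    (hl : ∀ τ ∈ Icc s t, u l τ < 0) (hr : ∀ τ ∈ Icc s t, 0 < u r τ)
    (h0 : ∀ x ∈ Icc l r, ∀ y ∈ Icc l r, x ≤ y → 0 < u x s → 0 < u y s)
    {α β : ℝ} (hα : l ≤ α) (hβ : β ≤ r)
    (hz : ∀ x ∈ Icc α β, u x t = 0) (hnz : ∀ x ∈ Icc α β, u x s ≠ 0)
    {φ φ' φ'' : ℝ → ℝ} {D K : ℝ}
    (h1 : ∀ x, HasDerivAt φ (φ' x) x) (h2 : ∀ x, HasDerivAt φ' (φ'' x) x) (h3 : ∀ x, |φ x| ≤ 1)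
    (h4 : ∀ x, |φ' x| ≤ D) (h5 : ∀ x, |φ'' x| ≤ D) (h6 : ∀ x, x ∉ Icc α β → φ x = 0)
    {c1 c2 : ℝ} (hc1 : c1 ∈ Icc α β) (hc2 : c2 ∈ Icc α β) (hc12 : c1 ≤ c2)
    (hφ1 : φ c1 = -1) (hφ2 : φ c2 = 1)
    (hK : K = 2 * M * (2 * D + 1)) (hM0 : 0 < M)
    (hM : M * (t - s) ≤ 1 / 2) (hKt : K * (t - s) ≤ 1 / 2) : False := by
  have hD : 0 ≤ D := (abs_nonneg _).trans (h4 0)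
  have hK0 : 0 ≤ K := by rw [hK]; positivity
  have hsI : s ∈ Icc s t := ⟨le_rfl, hst.le⟩
  have htI : t ∈ Icc s t := ⟨hst.le, le_rfl⟩
  have hlr : l ≤ r := hα.trans ((hc1.1.trans hc1.2).trans hβ)
  have hsub : ∀ x ∈ Icc α β, x ∈ Icc l r := fun x hx => ⟨hα.trans hx.1, hx.2.trans hβ⟩
  obtain ⟨δ, hδ, hδ'⟩ := cpt_lower (g := fun x => |u x s|) (p := α) (q := β)
    (((slice_cont hc hsI).mono hsub).abs) (fun x hx => abs_pos.2 (hnz x hx))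
  obtain ⟨d1, hd1, hd1'⟩ := cpt_lower (g := fun τ => -u l τ) (p := s) (q := t)
    (slice_cont' hc ⟨le_rfl, hlr⟩).neg (fun τ hτ => by linarith [hl τ hτ])
  obtain ⟨d2, hd2, hd2'⟩ := cpt_lower (g := fun τ => u r τ) (p := s) (q := t)
    (slice_cont' hc ⟨hlr, le_rfl⟩) hr
  obtain ⟨κ, hκ, k1, k2, k3⟩ : ∃ κ > 0, κ < δ ∧ κ * 2 < d1 ∧ κ * 2 < d2 := by
    obtain ⟨κ, e1, e2⟩ := exists_between (show 0 < min δ (min (d1 / 2) (d2 / 2)) by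
      simp only [lt_min_iff]; exact ⟨hδ, by linarith, by linarith⟩)
    simp only [lt_min_iff] at e2
    exact ⟨κ, e1, e2.1, by linarith [e2.2.1], by linarith [e2.2.2]⟩
  have hKτ : ∀ τ ∈ Icc s t, 0 ≤ K * (τ - s) ∧ K * (τ - s) ≤ 1 / 2 ∧ M * (τ - s) ≤ 1 / 2 := by
    intro τ hτ
    refine ⟨mul_nonneg hK0 (by linarith [hτ.1]), ?_, ?_⟩
    · refine le_trans ?_ hKt
      gcongr; exact hτ.2
    · refine le_trans ?_ hM
      gcongr; exact hτ.2
  have hsign : ∀ x, x ∈ Icc l r → (0 < u x s → 0 < u x s + κ * (-φ x)) ∧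
      (0 < u x s + κ * (-φ x) → 0 < u x s) := by
    intro x hx
    by_cases hxab : x ∈ Icc α β
    · have e1 := hδ' x hxab
      have e2 := abs_le.1 (h3 x)
      have e3 : |κ * (-φ x)| ≤ κ := by
        rw [abs_mul, abs_neg, abs_of_pos hκ]
        nlinarith [h3 x]
      rw [abs_le] at e3
      constructor
      · intro h; rw [abs_of_pos h] at e1; linarith
      · intro h
        by_contra hn
        push Not at hn
        rw [abs_of_nonpos hn] at e1; linarith
    · rw [h6 x hxab]; simp
  have hcφ : Continuous φ := continuous_iff_continuousAt.2 fun x => (h1 x).continuousAt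
  have key := lemA (a := a) (b := b) (c := c) (M := M)
    (P := fun x τ => u x τ + κ * (-φ x - K * (τ - s)))
    (N := fun x τ => u x τ + κ * (-φ x + K * (τ - s))) (l := l) (r := r) (t1 := s) (t2 := t)
    (hc.add (by fun_prop)) (hc.add (by fun_prop)) ?_ ?_ ?_ ?_ ?_ ?_ t htI c1 (hsub _ hc1) c2
    (hsub _ hc2) hc12 ?_
  · simp only [hz c2 hc2, hφ2] at key
    nlinarith
  · intro τ hτ x hx
    have e := hKτ τ ⟨hτ.1.le, hτ.2⟩
    have := (hS' τ hτ x hx).add ((barrier_sup (s := s) (hS' τ hτ x hx) h1 h2 h3 h4 h5 hK hτ.1.le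
      e.2.2).smul hκ.le)
    convert this using 3
    ring
  · intro τ hτ x hx
    have e := hKτ τ ⟨hτ.1.le, hτ.2⟩
    exact (hS τ hτ x hx).add ((barrier_sup (ψ := fun x => -φ x) (ψ' := fun x => -φ' x)
      (ψ'' := fun x => -φ'' x) (s := s) (hS τ hτ x hx)
      (fun x => (h1 x).neg) (fun x => (h2 x).neg) (by simpa using h3) (by simpa using h4)
      (by simpa using h5) hK hτ.1.le e.2.2).smul hκ.le)
  · intro τ hτ x hx
    have e := hKτ τ hτ
    have := mul_nonneg hκ.le e.1
    nlinarith
  · intro τ hτ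
    have e := hKτ τ hτ
    have e2 := abs_le.1 (h3 l)
    have e3 := hd1' τ hτ
    nlinarith
  · intro τ hτ
    have e := hKτ τ hτ
    have e2 := abs_le.1 (h3 r)
    have e3 := hd2' τ hτ
    nlinarith
  · intro x hx y hy hxy
    simp only [sub_self, mul_zero, sub_zero, add_zero]
    intro hp
    exact ((hsign y hy).1 (h0 x hx y hy hxy ((hsign x hx).2 hp))).le
  · simp only [hz c1 hc1, hφ1]
    nlinarith

theorem opp {a b c : ℝ → ℝ → ℝ} {M : ℝ} {u : ℝ → ℝ → ℝ} {l r t1 t2 : ℝ}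
    (hc : ContinuousOn (fun p : ℝ × ℝ => u p.1 p.2) (Icc l r ×ˢ Icc t1 t2))
    (hS : ∀ τ ∈ Ioc t1 t2, ∀ x ∈ Ioo l r, SupS a b c M u x τ)
    (hS' : ∀ τ ∈ Ioc t1 t2, ∀ x ∈ Ioo l r, SupS a b c M (fun x t => -u x t) x τ)
    (hl : ∀ τ ∈ Icc t1 t2, u l τ < 0) (hr : ∀ τ ∈ Icc t1 t2, 0 < u r τ)
    (h0 : ∀ x ∈ Icc l r, ∀ y ∈ Icc l r, x ≤ y → 0 < u x t1 → 0 ≤ u y t1)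
    {t : ℝ} (ht : t ∈ Ioc t1 t2) {p q : ℝ} (hp : p ∈ Icc l r) (hq : q ∈ Icc l r)
    (hup : u p t = 0) (huq : u q t = 0) : ¬ p < q := by
  intro hpq
  have hlr : l < r := hp.1.trans_lt (hpq.trans_le hq.2)
  have B0 := lemA (a := a) (b := b) (c := c) (M := M) (P := u) (N := u) hc hc hS' hS
    (fun _ _ _ _ => le_rfl) (fun τ hτ => (hl τ hτ).le) (fun τ hτ => (hr τ hτ).le) h0
  have B1 : ∀ τ ∈ Ioc t1 t2, ∀ x ∈ Icc l r, ∀ y ∈ Icc l r, x ≤ y → 0 < u x τ → 0 < u y τ := by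
    intro τ hτ x hx y hy hxy hux
    rcases hxy.lt_or_eq with hxy | rfl
    swap
    · exact hux
    rcases hy.2.lt_or_eq with hyr | rfl
    swap
    · exact hr τ ⟨hτ.1.le, hτ.2⟩
    obtain ⟨t', ht', hpos⟩ := left_time (slice_cont' hc hx) hτ hux
    have hsub : Icc t' τ ⊆ Icc t1 t2 := fun z hz => ⟨ht'.1.trans hz.1, hz.2.trans hτ.2⟩
    refine strong_pos' (a := a) (b := b) (c := c) (M := M) (A := x) (B := r) (t1 := t') ht'.2
      (hc.mono (prod_mono (Icc_subset_Icc_left hx.1) hsub)) ?_ ?_ (y := x) ⟨le_rfl, hx.2⟩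
      (hpos t' ⟨le_rfl, ht'.2.le⟩) ⟨hxy, hyr⟩
    · exact fun z hz w hw => hS z ⟨ht'.1.trans_lt hz.1, hz.2.trans hτ.2⟩ w ⟨hx.1.trans_lt hw.1, hw.2⟩
    · exact fun z hz w hw => B0 z (hsub hz) x hx w ⟨hx.1.trans hw.1, hw.2⟩ hw.1 (hpos z hz)
  have B2 : ∀ τ ∈ Ioc t1 t2, ∀ x ∈ Icc l r, ∀ y ∈ Icc l r, x ≤ y → u y τ < 0 → u x τ < 0 := by
    intro τ hτ x hx y hy hxy huy
    rcases hxy.lt_or_eq with hxy | rfl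
    swap
    · exact huy
    rcases hx.1.lt_or_eq with hxl | rfl
    swap
    · exact hl τ ⟨hτ.1.le, hτ.2⟩
    obtain ⟨t', ht', hpos⟩ := left_time (g := fun τ => -u y τ) (slice_cont' hc hy).neg hτ
      (by simpa using huy)
    have hsub : Icc t' τ ⊆ Icc t1 t2 := fun z hz => ⟨ht'.1.trans hz.1, hz.2.trans hτ.2⟩
    have := strong_pos' (a := a) (b := b) (c := c) (M := M) (f := fun x t => -u x t)
      (A := l) (B := y) (t1 := t') ht'.2
      (hc.mono (prod_mono (Icc_subset_Icc_right hy.2) hsub)).neg ?_ ?_ (y := y) ⟨hy.1, le_rfl⟩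
      (hpos t' ⟨le_rfl, ht'.2.le⟩) ⟨hxl, hxy⟩
    · simpa using this
    · exact fun z hz w hw => hS' z ⟨ht'.1.trans_lt hz.1, hz.2.trans hτ.2⟩ w ⟨hw.1, hw.2.trans_le hy.2⟩
    · intro z hz w hw
      have h1 := hpos z hz
      by_contra hcon
      push Not at hcon
      have := B0 z (hsub hz) w ⟨hw.1, hw.2.trans hy.2⟩ y hy hw.2 (by linarith)
      linarith
  have hflat : ∀ x ∈ Icc p q, u x t = 0 := by
    intro x hx
    have hxI : x ∈ Icc l r := ⟨hp.1.trans hx.1, hx.2.trans hq.2⟩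
    rcases lt_trichotomy (u x t) 0 with h | h | h
    · have := B2 t ht p hp x hxI hx.1 h; linarith
    · exact h
    · have := B1 t ht x hxI q hq hx.2 h; linarith
  obtain ⟨m, hm⟩ : ∃ m, m = (p + q) / 2 := ⟨_, rfl⟩
  have hpm : p < m := by linarith
  have hmq : m < q := by linarith
  have hmI : m ∈ Icc l r := ⟨hp.1.trans hpm.le, hmq.le.trans hq.2⟩
  obtain ⟨φ, φ', φ'', D, e1, e2, e3, e4, e5, e6, c1, hc1, c2, hc2, hcc, e7, e8⟩ := bump_exists hpm
  obtain ⟨χ, χ', χ'', D', g1, g2, g3, g4, g5, g6, d1, hd1, d2, hd2, hdd, g7, g8⟩ := bump_exists hmq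
  have hM0 : 0 < M := (hS t ht ((l + r) / 2) ⟨by linarith, by linarith⟩).1.1
  have hD0 : 0 ≤ D := (abs_nonneg _).trans (e4 0)
  have hD0' : 0 ≤ D' := (abs_nonneg _).trans (g4 0)
  obtain ⟨K, hK⟩ : ∃ K, K = 2 * M * (2 * D + 1) := ⟨_, rfl⟩
  obtain ⟨K', hK'⟩ : ∃ K', K' = 2 * M * (2 * D' + 1) := ⟨_, rfl⟩
  have hK0 : 0 ≤ K := by rw [hK]; positivity
  have hK0' : 0 ≤ K' := by rw [hK']; positivity
  obtain ⟨η, hη⟩ : ∃ η, η = 1 / (2 * (M + K + K')) := ⟨_, rfl⟩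
  have hη0 : 0 < η := by rw [hη]; positivity
  have hη1 : (M + K + K') * η = 1 / 2 := by rw [hη]; field_simp
  obtain ⟨t', h1t', ht't⟩ := exists_between (max_lt ht.1 (show t - η < t by linarith))
  obtain ⟨h1t', hηt'⟩ := max_lt_iff.1 h1t'
  obtain ⟨s, hs, hus⟩ : ∃ s ∈ Ico t' t, u m s ≠ 0 := by
    by_contra hcon
    push Not at hcon
    have hsub : Icc t' t ⊆ Icc t1 t2 := fun z hz => ⟨h1t'.le.trans hz.1, hz.2.trans ht.2⟩
    have := strong_pos' (a := a) (b := b) (c := c) (M := M) (f := u)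
      (A := m) (B := r) (t1 := t') ht't
      (hc.mono (prod_mono (Icc_subset_Icc_left hmI.1) hsub)) ?_ ?_ (y := r) ⟨hmI.2, le_rfl⟩
      (hr t' (hsub ⟨le_rfl, ht't.le⟩)) (x0 := (m + q) / 2) ⟨by linarith, by linarith [hq.2]⟩
    · rw [hflat ((m + q) / 2) ⟨by linarith, by linarith⟩] at this
      exact lt_irrefl _ this
    · exact fun z hz w hw => hS z ⟨h1t'.trans hz.1, hz.2.trans ht.2⟩ w ⟨hmI.1.trans_lt hw.1, hw.2⟩
    · intro z hz w hw
      have hmz : u m z = 0 := by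
        rcases hz.2.lt_or_eq with h | h
        · exact hcon z ⟨hz.1, h⟩
        · rw [h]; exact hflat m ⟨hpm.le, hmq.le⟩
      by_contra hneg
      push Not at hneg
      have := B2 z ⟨h1t'.trans_le hz.1, hz.2.trans ht.2⟩ m hmI w ⟨hmI.1.trans hw.1, hw.2⟩ hw.1 hneg
      linarith
  have hs1 : s ∈ Ioc t1 t2 := ⟨h1t'.trans_le hs.1, hs.2.le.trans ht.2⟩
  have hsub : Icc s t ⊆ Icc t1 t2 := fun z hz => ⟨hs1.1.le.trans hz.1, hz.2.trans ht.2⟩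
  have hts : t - s ≤ η := by linarith [hs.1]
  have hts0 : 0 ≤ t - s := by linarith [hs.2]
  have b1 : M * (t - s) ≤ 1 / 2 := by
    nlinarith [mul_le_mul_of_nonneg_left hts hM0.le, mul_nonneg hK0 hη0.le, mul_nonneg hK0' hη0.le]
  have b2 : K * (t - s) ≤ 1 / 2 := by
    nlinarith [mul_le_mul_of_nonneg_left hts hK0, mul_nonneg hM0.le hη0.le, mul_nonneg hK0' hη0.le]
  have b3 : K' * (t - s) ≤ 1 / 2 := by
    nlinarith [mul_le_mul_of_nonneg_left hts hK0', mul_nonneg hK0 hη0.le, mul_nonneg hM0.le hη0.le]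
  have hcs := hc.mono (prod_mono (Subset.refl (Icc l r)) hsub)
  have hSs : ∀ τ ∈ Ioc s t, ∀ x ∈ Ioo l r, SupS a b c M u x τ :=
    fun τ hτ => hS τ ⟨hs1.1.trans hτ.1, hτ.2.trans ht.2⟩
  have hSs' : ∀ τ ∈ Ioc s t, ∀ x ∈ Ioo l r, SupS a b c M (fun x t => -u x t) x τ :=
    fun τ hτ => hS' τ ⟨hs1.1.trans hτ.1, hτ.2.trans ht.2⟩
  rcases lt_or_gt_of_ne hus with hneg | hpos
  · refine flat_core hs.2 hcs hSs hSs' (fun τ hτ => hl τ (hsub hτ)) (fun τ hτ => hr τ (hsub hτ))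
      (B1 s hs1) hp.1 hmI.2 (fun x hx => hflat x ⟨hx.1, hx.2.trans hmq.le⟩) ?_ e1 e2 e3 e4 e5 e6
      hc1 hc2 hcc e7 e8 hK hM0 b1 b2
    intro x hx
    exact (B2 s hs1 x ⟨hp.1.trans hx.1, hx.2.trans hmI.2⟩ m hmI hx.2 hneg).ne
  · refine flat_core hs.2 hcs hSs hSs' (fun τ hτ => hl τ (hsub hτ)) (fun τ hτ => hr τ (hsub hτ))
      (B1 s hs1) hmI.1 hq.2 (fun x hx => hflat x ⟨hpm.le.trans hx.1, hx.2⟩) ?_ g1 g2 g3 g4 g5 g6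
      hd1 hd2 hdd g7 g8 hK' hM0 b1 b3
    intro x hx
    exact (B1 s hs1 m hmI x ⟨hmI.1.trans hx.1, hx.2.trans hq.2⟩ hx.1 hpos).ne'

theorem corner {a b c : ℝ → ℝ → ℝ} {M : ℝ} {f : ℝ → ℝ → ℝ} {ξ : ℝ → ℝ} {s t2 x1 : ℝ}
    (hξ : ContinuousOn ξ (Icc s t2))
    (hc : ContinuousOn (fun p : ℝ × ℝ => f p.1 p.2)
      {p : ℝ × ℝ | p.2 ∈ Icc s t2 ∧ p.1 ∈ Icc (ξ p.2) x1})
    (hS : ∀ t ∈ Ioc s t2, ∀ x ∈ Ioo (ξ t) x1, SupS a b c M f x t)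
    (h0 : ∀ x ∈ Icc (ξ s) x1, 0 ≤ f x s)
    (hR : ∀ t ∈ Icc s t2, 0 < f x1 t)
    (hL : ∀ t ∈ Ioc s t2, 0 < f (ξ t) t) :
    ∀ t ∈ Ioc s t2, ∀ x ∈ Icc (ξ t) x1, 0 < f x t := by
  have hW := weak_max (r := fun _ => x1) hξ continuousOn_const hc hS h0 (by
    intro t ht hle
    rcases ht.1.lt_or_eq with h | h
    · exact (hL t ⟨h, ht.2⟩).le
    · rw [← h] at hle ⊢; exact h0 _ ⟨le_rfl, hle⟩) (fun t ht _ => (hR t ht).le)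
  intro t ht x hx
  rcases hx.1.lt_or_eq with h1 | h1
  swap
  · rw [← h1]; exact hL t ht
  rcases hx.2.lt_or_eq with h2 | h2
  swap
  · rw [h2]; exact hR t ⟨ht.1.le, ht.2⟩
  obtain ⟨A, hA1, hA2⟩ := exists_between h1
  obtain ⟨t', ht', hlt⟩ := left_time (g := fun τ => A - ξ τ) (continuousOn_const.sub hξ) ht
    (by simpa using hA1)
  have hsub : ∀ τ ∈ Icc t' t, τ ∈ Icc s t2 := fun τ hτ => ⟨ht'.1.trans hτ.1, hτ.2.trans ht.2⟩
  have hlt' : ∀ τ ∈ Icc t' t, ξ τ < A := fun τ hτ => by have := hlt τ hτ; simp at this; exact this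
  refine strong_pos' (a := a) (b := b) (c := c) (M := M) (A := A) (B := x1) (t1 := t') ht'.2
    (hc.mono ?_) ?_ ?_ (y := x1) ⟨(hA2.trans h2).le, le_rfl⟩ (hR t' (hsub _ ⟨le_rfl, ht'.2.le⟩))
    ⟨hA2, h2⟩
  · rintro ⟨z, τ⟩ ⟨k1, k2⟩
    exact ⟨hsub τ k2, (hlt' τ k2).le.trans k1.1, k1.2⟩
  · intro τ hτ z hz
    exact hS τ ⟨ht'.1.trans_lt hτ.1, hτ.2.trans ht.2⟩ z
      ⟨(hlt' τ ⟨hτ.1.le, hτ.2⟩).trans hz.1, hz.2⟩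
  · intro τ hτ z hz
    exact hW τ (hsub τ hτ) z ⟨(hlt' τ hτ).le.trans hz.1, hz.2⟩

theorem sign_const {g : ℝ → ℝ} {p q x0 x : ℝ} (hg : ContinuousOn g (Icc p q))
    (hnz : ∀ x ∈ Icc p q, g x ≠ 0) (hx0 : x0 ∈ Icc p q) (h0 : 0 < g x0) (hx : x ∈ Icc p q) :
    0 < g x := by
  by_contra hn
  push Not at hn
  obtain ⟨z, hz, hz0⟩ := (convex_Icc p q).isPreconnected.intermediate_value hx hx0 hg ⟨hn, h0.le⟩
  exact hnz z hz hz0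

theorem zero_local_pos {a b c : ℝ → ℝ → ℝ} {M : ℝ} {u : ℝ → ℝ → ℝ} {l r s t2 y : ℝ}
    (hst : s ≤ t2)
    (hc : ContinuousOn (fun p : ℝ × ℝ => u p.1 p.2) (Icc l r ×ˢ Icc s t2))
    (hS : ∀ τ ∈ Ioc s t2, ∀ x ∈ Ioo l r, SupS a b c M u x τ)
    (hS' : ∀ τ ∈ Ioc s t2, ∀ x ∈ Ioo l r, SupS a b c M (fun x t => -u x t) x τ)
    (hl : ∀ τ ∈ Icc s t2, u l τ ≠ 0) (hr : ∀ τ ∈ Icc s t2, u r τ ≠ 0) (hrs : 0 < u r s)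
    (hy : y ∈ Ioo l r) (hy0 : u y s = 0) (huniq : ∀ x ∈ Icc l r, u x s = 0 → x = y)
    {t : ℝ} (ht : t ∈ Ioc s t2) {p q : ℝ} (hp : p ∈ Icc l r) (hq : q ∈ Icc l r)
    (hup : u p t = 0) (huq : u q t = 0) : p = q := by
  have hlr := hy.1.trans hy.2
  have hsI : s ∈ Icc s t2 := ⟨le_rfl, hst⟩
  have hcl := slice_cont' hc (x := l) ⟨le_rfl, hlr.le⟩
  have hcr := slice_cont' hc (x := r) ⟨hlr.le, le_rfl⟩
  have hcs := slice_cont hc hsI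
  have hr' : ∀ τ ∈ Icc s t2, 0 < u r τ := fun τ hτ => sign_const hcr hr hsI hrs hτ
  have hright : ∀ x ∈ Icc l r, y < x → 0 < u x s := by
    intro x hx hyx
    refine sign_const (g := fun x => u x s) (p := x) (q := r) (hcs.mono (Icc_subset_Icc_left hx.1)) ?_ (x0 := r)
      ⟨hx.2, le_rfl⟩ hrs ⟨le_rfl, hx.2⟩
    intro z hz h
    have := huniq z ⟨hx.1.trans hz.1, hz.2⟩ h
    linarith [hz.1]
  rcases lt_or_gt_of_ne (hl s hsI) with h | h
  · have hl' : ∀ τ ∈ Icc s t2, u l τ < 0 := by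
      intro τ hτ
      have := sign_const (g := fun τ => -u l τ) hcl.neg (fun z hz => neg_ne_zero.2 (hl z hz)) hsI
        (by simpa using h) hτ
      simpa using this
    have hleft : ∀ x ∈ Icc l r, x < y → u x s < 0 := by
      intro x hx hyx
      have := sign_const (g := fun z => -u z s) (p := l) (q := x)
        (hcs.mono (Icc_subset_Icc_right hx.2)).neg ?_ (x0 := l)
        ⟨le_rfl, hx.1⟩ (by simpa using h) (x := x) ⟨hx.1, le_rfl⟩
      · simpa using this
      intro z hz h
      have := huniq z ⟨hz.1, hz.2.trans hx.2⟩ (by simpa using h)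
      linarith [hz.2]
    have h0 : ∀ x ∈ Icc l r, ∀ z ∈ Icc l r, x ≤ z → 0 < u x s → 0 ≤ u z s := by
      intro x hx z hz hxz hpos
      have hyx : y ≤ x := by
        by_contra hn
        push Not at hn
        linarith [hleft x hx hn]
      rcases (hyx.trans hxz).lt_or_eq with h1 | h1
      · exact (hright z hz h1).le
      · rw [← h1, hy0]
    rcases lt_trichotomy p q with k | k | k
    · exact absurd k (opp hc hS hS' hl' hr' h0 ht hp hq hup huq)
    · exact k
    · exact absurd k (opp hc hS hS' hl' hr' h0 ht hq hp huq hup)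
  · exfalso
    have hl' : ∀ τ ∈ Icc s t2, 0 < u l τ := fun τ hτ => sign_const hcl hl hsI h hτ
    have hleft : ∀ x ∈ Icc l r, x < y → 0 < u x s := by
      intro x hx hyx
      refine sign_const (g := fun x => u x s) (p := l) (q := x) (hcs.mono (Icc_subset_Icc_right hx.2)) ?_ (x0 := l)
        ⟨le_rfl, hx.1⟩ h ⟨hx.1, le_rfl⟩
      intro z hz h
      have := huniq z ⟨hz.1, hz.2.trans hx.2⟩ h
      linarith [hz.2]
    have := corner (a := a) (b := b) (c := c) (M := M) (f := u) (ξ := fun _ => l) (s := s)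
      (t2 := t2) (x1 := r) continuousOn_const (hc.mono fun p hp => ⟨hp.2, hp.1⟩) hS ?_ hr'
      (fun τ hτ => hl' τ ⟨hτ.1.le, hτ.2⟩) t ht p hp
    · linarith
    · intro x hx
      rcases lt_trichotomy x y with k | k | k
      · exact (hleft x hx k).le
      · rw [k, hy0]
      · exact (hright x hx k).le

theorem zero_local {a b c : ℝ → ℝ → ℝ} {M : ℝ} {u : ℝ → ℝ → ℝ} {l r s t2 y : ℝ}
    (hst : s ≤ t2)
    (hc : ContinuousOn (fun p : ℝ × ℝ => u p.1 p.2) (Icc l r ×ˢ Icc s t2))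
    (hS : ∀ τ ∈ Ioc s t2, ∀ x ∈ Ioo l r, SupS a b c M u x τ)
    (hS' : ∀ τ ∈ Ioc s t2, ∀ x ∈ Ioo l r, SupS a b c M (fun x t => -u x t) x τ)
    (hl : ∀ τ ∈ Icc s t2, u l τ ≠ 0) (hr : ∀ τ ∈ Icc s t2, u r τ ≠ 0)
    (hy : y ∈ Ioo l r) (hy0 : u y s = 0) (huniq : ∀ x ∈ Icc l r, u x s = 0 → x = y)
    {t : ℝ} (ht : t ∈ Ioc s t2) {p q : ℝ} (hp : p ∈ Icc l r) (hq : q ∈ Icc l r)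
    (hup : u p t = 0) (huq : u q t = 0) : p = q := by
  rcases lt_or_gt_of_ne (hr s ⟨le_rfl, hst⟩) with h | h
  · exact zero_local_pos (a := a) (b := b) (c := c) (M := M) (u := fun x t => -u x t) hst hc.neg hS'
      (by simpa using hS) (by simpa using hl) (by simpa using hr) (by simpa using h) hy
      (by simpa using hy0) (by simpa using huniq) ht hp hq (by simpa using hup) (by simpa using huq)
  · exact zero_local_pos hst hc hS hS' hl hr h hy hy0 huniq ht hp hq hup huq

theorem slab {s : ℝ} {P : ℝ → Prop} (h : ∀ᶠ t in 𝓝 s, P t) : ∃ t2 > s, ∀ t ∈ Icc s t2, P t := by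
  obtain ⟨δ, hδ, h'⟩ := Metric.eventually_nhds_iff.1 h
  refine ⟨s + δ / 2, by linarith, fun t ht => h' ?_⟩
  rw [Real.dist_eq, abs_lt]
  constructor <;> linarith [ht.1, ht.2]

theorem finite_iso {S : Set ℝ} (hS : S.Finite) (y : ℝ) : ∃ δ > 0, ∀ x ∈ S, |x - y| < δ → x = y := by
  have h : (S \ {y})ᶜ ∈ 𝓝 y := (hS.subset sdiff_subset).isClosed.isOpen_compl.mem_nhds (by simp)
  obtain ⟨δ, hδ, h'⟩ := Metric.mem_nhds_iff.1 h
  refine ⟨δ, hδ, fun x hx hd => ?_⟩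
  by_contra hne
  exact h' (by rwa [Metric.mem_ball, Real.dist_eq]) ⟨hx, hne⟩

/-- Lemma 2.5: at a *ZN-moment `s` of `w₁` satisfying (H3) with `Z(s) < ∞`, the number
of zeroes drops strictly: `Z(s) > Z(t)` for all `t > s` sufficiently close to `s`. -/
theorem starZN_moment_strict_decrease
    (T X : ℝ) (xi1 : ℝ → ℝ) (a b c u : ℝ → ℝ → ℝ)
    (hT : 0 < T)
    (hxc : ContinuousOn xi1 (Icc 0 T)) (hxlt : ∀ t ∈ Icc (0:ℝ) T, xi1 t < X)
    (hsol : IsClassicalSolution a b c xi1 (fun _ => X) T u)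
    (hreg : Reg12 a b c xi1 (fun _ => X) T)
    (hX : ∀ t ∈ Icc (0:ℝ) T, u X t ≠ 0)
    (hnz : ∀ t ∈ Icc (0:ℝ) T, ∃ x ∈ Icc (xi1 t) X, u x t ≠ 0)
    (s : ℝ) (hs : s ∈ Ioo (0:ℝ) T)
    (hZ : u (xi1 s) s = 0)
    (hrN : rightN (bdryTrace u xi1) s)
    (hH3 : H3one u xi1 s)
    (hfin : Znum u xi1 (fun _ => X) s < ⊤) :
    ∃ ε > 0, ∀ t ∈ Ioo s (s + ε),
      Znum u xi1 (fun _ => X) t < Znum u xi1 (fun _ => X) s := by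
  obtain ⟨M, hM⟩ := hreg
  have hSS : ∀ t ∈ Ioc (0:ℝ) T, ∀ x ∈ Ioo (xi1 t) X,
      SupS a b c M u x t ∧ SupS a b c M (fun x t => -u x t) x t := by
    intro t ht x hx
    have hp : (x, t) ∈ domLat xi1 (fun _ => X) T := ⟨ht, hx.1.le, hx.2.le⟩
    obtain ⟨h1, -, -, -, -, -, h2, h3, -, -, -, h4, -, -, h5⟩ := hM _ hp
    simp only at h1 h2 h3 h4 h5
    rw [abs_of_pos (inv_pos.2 h1)] at h3
    rw [abs_of_pos h1] at h2
    have hM0 : 0 < M := h1.trans_le h2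
    have hb : 0 < M ∧ M⁻¹ ≤ a x t ∧ a x t ≤ M ∧ |b x t| ≤ M ∧ |c x t| ≤ M :=
      ⟨hM0, (inv_le_comm₀ h1 hM0).1 h3, h2, h4, h5⟩
    have e1 : ∀ᶠ y in 𝓝 x, HasDerivAt (fun y => u y t) (pdx u y t) y := by
      filter_upwards [Ioo_mem_nhds hx.1 hx.2] with y hy
      exact (hsol.diff_x (y, t) ⟨ht, hy.1.le, hy.2.le⟩).hasDerivAt
    have e2 : HasDerivAt (fun y => pdx u y t) (pdxx u x t) x := (hsol.diff_xx (x, t) hp).hasDerivAt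
    have e3 : HasDerivAt (fun τ => u x τ) (pdt u x t) t := (hsol.diff_t (x, t) hp).hasDerivAt
    have e4 := hsol.eqn (x, t) hp
    simp only at e4
    refine ⟨⟨hb, fun y => pdx u y t, pdt u x t, pdxx u x t, e1, e2, e3, e4.ge⟩,
      ⟨hb, fun y => -pdx u y t, -pdt u x t, -pdxx u x t, ?_, e2.neg, e3.neg, ?_⟩⟩
    · filter_upwards [e1] with y hy using hy.neg
    · linarith
  have hs0 : s ∈ Icc (0:ℝ) T := ⟨hs.1.le, hs.2.le⟩
  have hcl := hsol.cont
  have hxis : ContinuousAt xi1 s := hxc.continuousAt (Icc_mem_nhds hs.1 hs.2)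
  have htT : ∀ᶠ t in 𝓝 s, t ∈ Ioo (0:ℝ) T := Ioo_mem_nhds hs.1 hs.2
  have hxi : ∀ x, xi1 s < x → ∀ᶠ t in 𝓝 s, xi1 t < x := fun x hx => hxis.eventually (gt_mem_nhds hx)
  have hut : ∀ x, xi1 s < x → x ≤ X → ContinuousAt (fun t => u x t) s := by
    intro x hx hxX
    have h1 := hcl (x, s) ⟨hs0, hx.le, hxX⟩
    have h2 : Tendsto (fun t : ℝ => (x, t)) (𝓝 s) (𝓝[domCl xi1 (fun _ => X) T] (x, s)) := by
      refine tendsto_nhdsWithin_iff.2 ⟨Continuous.tendsto (by fun_prop) s, ?_⟩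
      filter_upwards [htT, hxi x hx] with t k1 k2
      exact ⟨⟨k1.1.le, k1.2.le⟩, k2.le, hxX⟩
    exact h1.tendsto.comp h2
  have hsX := hxlt s hs0
  let ZS := zeroSet u xi1 (fun _ => X) s
  have hZfin : ZS.Finite := encard_lt_top_iff.1 hfin
  have hZmem : xi1 s ∈ ZS := ⟨⟨le_rfl, hsX.le⟩, hZ⟩
  -- near the corner
  obtain ⟨x1, hx1, hx1X, hE1⟩ : ∃ x1, xi1 s < x1 ∧ x1 < X ∧
      ∀ᶠ t in 𝓝[>] s, ∀ x ∈ Icc (xi1 t) x1, u x t ≠ 0 := by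
    obtain ⟨δ1, hδ1, hiso⟩ := finite_iso hZfin (xi1 s)
    obtain ⟨ε1, hε1, hN⟩ := hrN
    obtain ⟨ε2, hε2, δ2, hδ2, hH⟩ := hH3
    obtain ⟨x1, k1, k2⟩ := exists_between (show xi1 s < min X (min (xi1 s + δ1) (xi1 s + δ2)) by
      simp only [lt_min_iff]; exact ⟨hsX, by linarith, by linarith⟩)
    simp only [lt_min_iff] at k2
    have hne : ∀ x ∈ Ioc (xi1 s) x1, u x s ≠ 0 := by
      intro x hx h0
      have := hiso x ⟨⟨hx.1.le, hx.2.trans k2.1.le⟩, h0⟩ (by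
        rw [abs_lt]; constructor <;> linarith [hx.1, hx.2])
      linarith [hx.1]
    have hcs : ContinuousOn (fun x => u x s) (Icc (xi1 s) X) :=
      hcl.comp (f := fun x => (x, s)) (by fun_prop) (fun z hz => ⟨hs0, hz⟩)
    refine ⟨x1, k1, k2.1, ?_⟩
    have hne1 := (hut x1 k1 k2.1.le).eventually_ne (hne x1 ⟨k1, le_rfl⟩)
    have hee : ∀ᶠ t in 𝓝 s, t < min (s + ε1) (s + ε2) :=
      gt_mem_nhds (lt_min (by linarith) (by linarith))
    obtain ⟨t2, ht2, hslab⟩ := slab (hne1.and (hee.and (htT.and (hxi x1 k1))))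
    have hnew : ∀ t ∈ Ioc s t2, u (xi1 t) t ≠ 0 ∧ 0 ≤ u (xi1 t) t * u x1 s := by
      intro t ht
      have hh := (hslab t ⟨ht.1.le, ht.2⟩).2.1
      rw [lt_min_iff] at hh
      refine ⟨hN t ⟨ht.1, hh.1⟩, ?_⟩
      have := hH t ⟨ht.1, hh.2⟩ x1 k1 (by linarith)
      linarith
    have hsubT : ∀ t ∈ Icc s t2, t ∈ Icc (0:ℝ) T := fun t ht =>
      ⟨(hslab t ht).2.2.1.1.le, (hslab t ht).2.2.1.2.le⟩
    have hsubT' : ∀ t ∈ Ioc s t2, t ∈ Ioc (0:ℝ) T := fun t ht =>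
      ⟨hs.1.trans ht.1, (hsubT t ⟨ht.1.le, ht.2⟩).2⟩
    have hcx1 : ContinuousOn (fun t => u x1 t) (Icc s t2) :=
      hcl.comp (f := fun t => (x1, t)) (by fun_prop) (fun t ht => ⟨hsubT t ht, (hslab t ht).2.2.2.le, k2.1.le⟩)
    have hcR : ContinuousOn (fun p : ℝ × ℝ => u p.1 p.2)
        {p : ℝ × ℝ | p.2 ∈ Icc s t2 ∧ p.1 ∈ Icc (xi1 p.2) x1} :=
      hcl.mono fun p hp => ⟨hsubT _ hp.1, hp.2.1, hp.2.2.trans k2.1.le⟩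
    have hsI : s ∈ Icc s t2 := ⟨le_rfl, ht2.le⟩
    filter_upwards [Ioc_mem_nhdsGT ht2] with t ht x hx
    rcases lt_or_gt_of_ne (hne x1 ⟨k1, le_rfl⟩) with hneg | hpos
    · have := corner (a := a) (b := b) (c := c) (M := M) (f := fun x t => -u x t) (ξ := xi1)
        (s := s) (t2 := t2) (x1 := x1) (hxc.mono hsubT) hcR.neg
        (fun t ht x hx => (hSS t (hsubT' t ht) x ⟨hx.1, hx.2.trans k2.1⟩).2) ?_ ?_ ?_ t ht x hx
      · exact (neg_pos.1 this).ne
      · intro z hz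
        rcases hz.1.lt_or_eq with h | h
        · refine (sign_const (g := fun z => -u z s) (p := z) (q := x1) (hcs.mono
            (Icc_subset_Icc hz.1 k2.1.le)).neg ?_ (x0 := x1) ⟨hz.2, le_rfl⟩ (by simpa using hneg)
            ⟨le_rfl, hz.2⟩).le
          exact fun w hw => neg_ne_zero.2 (hne w ⟨h.trans_le hw.1, hw.2⟩)
        · rw [← h, hZ]; simp
      · intro τ hτ
        exact sign_const (g := fun τ => -u x1 τ) hcx1.neg (fun w hw => neg_ne_zero.2 (hslab w hw).1)
          hsI (by simpa using hneg) hτ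
      · intro τ hτ
        obtain ⟨h1, h2⟩ := hnew τ hτ
        rcases lt_or_gt_of_ne h1 with h | h
        · simpa using h
        · exact absurd (mul_neg_of_pos_of_neg h hneg) (not_lt.2 h2)
    · have := corner (a := a) (b := b) (c := c) (M := M) (f := u) (ξ := xi1)
        (s := s) (t2 := t2) (x1 := x1) (hxc.mono hsubT) hcR
        (fun t ht x hx => (hSS t (hsubT' t ht) x ⟨hx.1, hx.2.trans k2.1⟩).1) ?_ ?_ ?_ t ht x hx
      · exact this.ne'
      · intro z hz
        rcases hz.1.lt_or_eq with h | h
        · refine (sign_const (g := fun z => u z s) (p := z) (q := x1) (hcs.mono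
            (Icc_subset_Icc hz.1 k2.1.le)) ?_ (x0 := x1) ⟨hz.2, le_rfl⟩ hpos
            ⟨le_rfl, hz.2⟩).le
          exact fun w hw => (hne w ⟨h.trans_le hw.1, hw.2⟩)
        · rw [← h, hZ]
      · intro τ hτ
        exact sign_const (g := fun τ => u x1 τ) hcx1 (fun w hw => (hslab w hw).1)
          hsI hpos hτ
      · intro τ hτ
        obtain ⟨h1, h2⟩ := hnew τ hτ
        rcases lt_or_gt_of_ne h1 with h | h
        · exact absurd (mul_neg_of_neg_of_pos h hpos) (not_lt.2 h2)
        · exact h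
  -- near the other zeros
  let F : Set ℝ := ZS \ {xi1 s}
  have hFfin : F.Finite := hZfin.subset sdiff_subset
  have hE2 : ∀ y ∈ F, ∃ ρ > 0, ∀ᶠ t in 𝓝[>] s, ∀ p ∈ Icc (y - ρ) (y + ρ), ∀ q ∈ Icc (y - ρ) (y + ρ),
      u p t = 0 → u q t = 0 → p = q := by
    rintro y ⟨⟨⟨hy1, hy2⟩, hy0⟩, hyne⟩
    have hy1' : xi1 s < y := lt_of_le_of_ne hy1 (fun h => hyne h.symm)
    have hy2' : y < X := lt_of_le_of_ne hy2 (fun h => hX s hs0 (h ▸ hy0))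
    obtain ⟨δ, hδ, hiso⟩ := finite_iso hZfin y
    obtain ⟨ρ, k1, k2⟩ := exists_between (show 0 < min δ (min (y - xi1 s) (X - y)) by
      simp only [lt_min_iff]; exact ⟨hδ, by linarith, by linarith⟩)
    simp only [lt_min_iff] at k2
    have huniq : ∀ x ∈ Icc (y - ρ) (y + ρ), u x s = 0 → x = y := by
      intro x hx h0
      exact hiso x ⟨⟨by linarith [hx.1], by linarith [hx.2]⟩, h0⟩ (by
        rw [abs_lt]; constructor <;> linarith [hx.1, hx.2])
    have n1 := (hut (y - ρ) (by linarith) (by linarith)).eventually_ne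
      (fun h => by have := huniq (y - ρ) ⟨le_rfl, by linarith⟩ h; linarith : u (y - ρ) s ≠ 0)
    have n2 := (hut (y + ρ) (by linarith) (by linarith)).eventually_ne
      (fun h => by have := huniq (y + ρ) ⟨by linarith, le_rfl⟩ h; linarith : u (y + ρ) s ≠ 0)
    obtain ⟨t2, ht2, hslab⟩ := slab (n1.and (n2.and ((hxi (y - ρ) (by linarith)).and htT)))
    refine ⟨ρ, k1, ?_⟩
    filter_upwards [Ioc_mem_nhdsGT ht2] with t ht p hp q hq hup huq
    have hin : ∀ τ ∈ Ioc s t2, ∀ x ∈ Ioo (y - ρ) (y + ρ), τ ∈ Ioc 0 T ∧ x ∈ Ioo (xi1 τ) X := by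
      intro τ hτ x hx
      have h := hslab τ ⟨hτ.1.le, hτ.2⟩
      exact ⟨⟨h.2.2.2.1, h.2.2.2.2.le⟩, h.2.2.1.trans hx.1, by linarith [hx.2]⟩
    refine zero_local (a := a) (b := b) (c := c) (M := M) (l := y - ρ) (r := y + ρ) (s := s)
      (t2 := t2) (y := y) ht2.le (hcl.mono ?_)
      (fun τ hτ x hx => (hSS τ (hin τ hτ x hx).1 x (hin τ hτ x hx).2).1)
      (fun τ hτ x hx => (hSS τ (hin τ hτ x hx).1 x (hin τ hτ x hx).2).2)
      (fun τ hτ => (hslab τ hτ).1) (fun τ hτ => (hslab τ hτ).2.1) ⟨by linarith, by linarith⟩ hy0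
      huniq ht hp hq hup huq
    rintro ⟨z, τ⟩ ⟨h1, h2⟩
    have h := hslab τ h2
    exact ⟨⟨h.2.2.2.1.le, h.2.2.2.2.le⟩, h.2.2.1.le.trans h1.1, by
      have := h1.2; simp only at this ⊢; linarith⟩
  choose! ρ hρ hE2 using hE2
  have hE2' : ∀ᶠ t in 𝓝[>] s, ∀ y ∈ F, ∀ p ∈ Icc (y - ρ y) (y + ρ y),
      ∀ q ∈ Icc (y - ρ y) (y + ρ y), u p t = 0 → u q t = 0 → p = q :=
    (eventually_all_finite hFfin).2 hE2
  -- compactness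
  have hE3 : ∀ᶠ t in 𝓝[>] s, ∀ x ∈ Icc x1 X, x ∈ Icc (xi1 t) X → u x t = 0 →
      ∃ y ∈ F, x ∈ Icc (y - ρ y) (y + ρ y) := by
    refine (isCompact_Icc (a := x1) (b := X)).induction_on (p := fun S => ∀ᶠ t in 𝓝[>] s, ∀ x ∈ S,
      x ∈ Icc (xi1 t) X → u x t = 0 → ∃ y ∈ F, x ∈ Icc (y - ρ y) (y + ρ y)) ?_ ?_ ?_ ?_
    · simp
    · intro S S' hSS' h
      filter_upwards [h] with t ht x hx using ht x (hSS' hx)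
    · intro S S' h h'
      filter_upwards [h, h'] with t ht ht' x hx
      rcases hx with hx | hx
      · exact ht x hx
      · exact ht' x hx
    · intro y hy
      by_cases hy0 : u y s = 0
      · have hyF : y ∈ F := ⟨⟨⟨hx1.le.trans hy.1, hy.2⟩, hy0⟩, fun h => by
          have h' : y = xi1 s := h
          linarith [hy.1]⟩
        have := hρ y hyF
        exact ⟨Icc (y - ρ y) (y + ρ y), mem_nhdsWithin_of_mem_nhds (Icc_mem_nhds (by linarith)
          (by linarith)), Eventually.of_forall fun t x hx _ _ => ⟨y, hyF, hx⟩⟩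
      · have h1 := (hcl (y, s) ⟨hs0, hx1.le.trans hy.1, hy.2⟩).eventually_ne hy0
        rw [Metric.nhdsWithin_basis_ball.eventually_iff] at h1
        obtain ⟨δ, hδ, h⟩ := h1
        refine ⟨Metric.ball y δ, mem_nhdsWithin_of_mem_nhds (Metric.ball_mem_nhds y hδ), ?_⟩
        have h2 : ∀ᶠ t in 𝓝[>] s, t ∈ Metric.ball s δ ∧ t ∈ Ioo (0:ℝ) T :=
          nhdsWithin_le_nhds ((show ∀ᶠ t in 𝓝 s, t ∈ Metric.ball s δ from Metric.ball_mem_nhds s hδ).and htT)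
        filter_upwards [h2] with t ht x hx hxI h0
        refine absurd h0 (h (x := (x, t)) ⟨?_, ⟨ht.2.1.le, ht.2.2.le⟩, hxI⟩)
        rw [Metric.mem_ball, Prod.dist_eq]
        exact max_lt hx ht.1
  have hfinal : ∀ᶠ t in 𝓝[>] s, Znum u xi1 (fun _ => X) t < Znum u xi1 (fun _ => X) s := by
    filter_upwards [hE1, hE2', hE3] with t h1 h2 h3
    have hmap : ∀ x ∈ zeroSet u xi1 (fun _ => X) t, ∃ y ∈ F, x ∈ Icc (y - ρ y) (y + ρ y) := by
      rintro x ⟨hxI, hx0⟩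
      refine h3 x ⟨?_, hxI.2⟩ hxI hx0
      by_contra hn
      push Not at hn
      exact h1 x ⟨hxI.1, hn.le⟩ hx0
    choose! φ hφ1 hφ2 using hmap
    have hle : (zeroSet u xi1 (fun _ => X) t).encard ≤ F.encard := by
      refine encard_le_encard_of_injOn (f := φ) hφ1 ?_
      intro x hx x' hx' he
      exact h2 (φ x) (hφ1 x hx) x (hφ2 x hx) x' (he ▸ hφ2 x' hx') hx.2 hx'.2
    refine hle.trans_lt ?_
    exact hFfin.encard_lt_encard ⟨sdiff_subset, fun h => (h hZmem).2 rfl⟩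
  obtain ⟨z, hz, hz'⟩ := mem_nhdsGT_iff_exists_Ioo_subset.1 hfinal
  refine ⟨z - s, by have : s < z := hz; linarith, fun t ht => hz' ⟨ht.1, by linarith [ht.2]⟩⟩
end

section
/- In the one-boundary setting (ξ₂(t) ≡ X constant and u(X,t) ≠ 0 for all t ∈ [0,T]): let s ∈ (0,T) be a *ZZ- or *ZX-moment of w₁(t) := u(ξ₁(t),t), i.e. w₁(s) = 0 and every right neighborhood of s contains another Z-moment of w₁. Assume (H3) holds at s (with i = 1) and Z(s) < ∞. Then Z(s) ≥ Z(t) for all t > s sufficiently close to s. -/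
open Set

open Filter Topology

def PD (M : ℝ) (u : ℝ → ℝ → ℝ) (x t : ℝ) : Prop :=
  (∀ᶠ y in 𝓝 x, DifferentiableAt ℝ (fun y => u y t) y) ∧
  DifferentiableAt ℝ (fun y => pdx u y t) x ∧ DifferentiableAt ℝ (fun s => u x s) t ∧
  ∃ α β κ : ℝ, M⁻¹ ≤ α ∧ α ≤ M ∧ |β| ≤ M ∧ |κ| ≤ M ∧
    pdt u x t = α * pdxx u x t + β * pdx u x t + κ * u x t

lemma PD.neg {M : ℝ} {u : ℝ → ℝ → ℝ} {x t : ℝ} (h : PD M u x t) :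
    PD M (fun x t => - u x t) x t := by
  obtain ⟨h1, h2, h3, α, β, κ, ha, ha', hb, hc, he⟩ := h
  have e1 : ∀ y, pdx (fun x t => - u x t) y t = - pdx u y t := by
    intro y; simp only [pdx]; exact deriv.fun_neg
  have e2 : pdxx (fun x t => - u x t) x t = - pdxx u x t := by
    simp only [pdxx, e1]; exact deriv.fun_neg
  have e3 : pdt (fun x t => - u x t) x t = - pdt u x t := by
    simp only [pdt]; exact deriv.fun_neg
  refine ⟨h1.mono fun y hy => hy.neg, ?_, h3.neg, α, β, κ, ha, ha', hb, hc, ?_⟩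
  · simp only [e1]; exact h2.neg
  · rw [e1, e2, e3, he]; ring

lemma PD.refl {M : ℝ} {u : ℝ → ℝ → ℝ} {x t : ℝ} (h : PD M u (-x) t) :
    PD M (fun x t => u (-x) t) x t := by
  obtain ⟨h1, h2, h3, α, β, κ, ha, ha', hb, hc, he⟩ := h
  have e1 : ∀ y, pdx (fun x t => u (-x) t) y t = - pdx u (-y) t := by
    intro y; simp only [pdx]; exact deriv_comp_neg (fun y => u y t) y
  have e2 : pdxx (fun x t => u (-x) t) x t = pdxx u (-x) t := by
    simp only [pdxx, e1]
    rw [deriv.fun_neg, deriv_comp_neg (fun y => pdx u y t) x, neg_neg]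
  have e3 : pdt (fun x t => u (-x) t) x t = pdt u (-x) t := rfl
  refine ⟨?_, ?_, h3, α, -β, κ, ha, ha', by simpa using hb, hc, ?_⟩
  · have : Tendsto (fun y : ℝ => -y) (𝓝 x) (𝓝 (-x)) := (continuous_neg.tendsto x)
    refine (this.eventually h1).mono fun y hy => ?_
    exact DifferentiableAt.comp (f := fun y : ℝ => -y) y hy differentiableAt_id.neg
  · simp only [e1]
    exact (DifferentiableAt.comp (f := fun y : ℝ => -y) x h2 differentiableAt_id.neg).neg
  · rw [e1, e2, e3, he]; ring

lemma second_deriv_nonpos {f f' : ℝ → ℝ} {f'' x : ℝ} (h1 : ∀ᶠ y in 𝓝 x, HasDerivAt f (f' y) y)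
    (h2 : HasDerivAt f' f'' x) (hm : IsLocalMax f x) : f'' ≤ 0 := by
  by_contra hlt
  push Not at hlt
  have hd : deriv f =ᶠ[𝓝 x] f' := h1.mono fun y hy => hy.deriv
  have h0 : deriv f x = 0 := hm.deriv_eq_zero
  have hdd : deriv (deriv f) x = f'' := by rw [hd.deriv_eq]; exact h2.deriv
  have hmin : IsLocalMin f x :=
    isLocalMin_of_deriv_deriv_pos (by rw [hdd]; exact hlt) h0 h1.self_of_nhds.continuousAt
  have hc : f =ᶠ[𝓝 x] fun _ => f x := by
    filter_upwards [hm, hmin] with y a b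
    exact le_antisymm a b
  have : deriv (deriv f) x = 0 := by
    rw [hc.deriv.deriv_eq]; simp
  linarith

lemma left_deriv_nonneg {g : ℝ → ℝ} {g' t : ℝ} (h : HasDerivAt g g' t)
    (hm : ∀ᶠ σ in 𝓝[<] t, g σ ≤ g t) : 0 ≤ g' := by
  have h1 := (hasDerivWithinAt_iff_tendsto_slope' (s := Iio t) (by simp)).1 h.hasDerivWithinAt
  refine ge_of_tendsto h1 ?_
  filter_upwards [hm, self_mem_nhdsWithin] with σ h2 h3
  rw [slope_def_field]
  exact div_nonneg_of_nonpos (by linarith) (by simp at h3; linarith)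

lemma core {M : ℝ} {u φ : ℝ → ℝ → ℝ} {x t : ℝ} (h : PD M u x t)
    (φx : ℝ → ℝ) (φxx φt : ℝ) (h1 : ∀ y, HasDerivAt (fun y => φ y t) (φx y) y)
    (h2 : HasDerivAt φx φxx x) (h3 : HasDerivAt (fun σ => φ x σ) φt t)
    (hM : 1 ≤ M)
    (hsub : ∀ α β κ : ℝ, M⁻¹ ≤ α → α ≤ M → |β| ≤ M → |κ| ≤ M →
      φt ≤ α * φxx + β * φx x + κ * φ x t)
    (hpos : 0 < φ x t - u x t)
    (hmax : ∃ δ > 0, ∀ x' ∈ Ioo (x - δ) (x + δ), ∀ τ ∈ Ioc (t - δ) t,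
      Real.exp (-(M + 1) * τ) * (φ x' τ - u x' τ) ≤ Real.exp (-(M + 1) * t) * (φ x t - u x t)) :
    False := by
  obtain ⟨g1, g2, g3, α, β, κ, ha, ha', hb, hc, he⟩ := h
  obtain ⟨δ, hδ, hmax⟩ := hmax
  have hlm : IsLocalMax (fun y => φ y t - u y t) x := by
    filter_upwards [Ioo_mem_nhds (show x - δ < x by linarith) (show x < x + δ by linarith)]
      with y hy
    have := hmax y hy t ⟨by linarith, le_rfl⟩
    exact le_of_mul_le_mul_left this (Real.exp_pos _)
  have d1 : ∀ᶠ y in 𝓝 x, HasDerivAt (fun y => φ y t - u y t) (φx y - pdx u y t) y :=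
    g1.mono fun y hy => (h1 y).sub hy.hasDerivAt
  have d2 : HasDerivAt (fun y => φx y - pdx u y t) (φxx - pdxx u x t) x :=
    h2.sub g2.hasDerivAt
  have s2 := second_deriv_nonpos d1 d2 hlm
  have s1 : φx x - pdx u x t = 0 := hlm.hasDerivAt_eq_zero d1.self_of_nhds
  have d3 : HasDerivAt (fun σ => Real.exp (-(M + 1) * σ) * (φ x σ - u x σ))
      (Real.exp (-(M + 1) * t) * (-(M + 1)) * (φ x t - u x t)
        + Real.exp (-(M + 1) * t) * (φt - pdt u x t)) t := by
    have e1 : HasDerivAt (fun σ : ℝ => -(M + 1) * σ) (-(M + 1)) t := by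
      simpa using (hasDerivAt_id t).const_mul (-(M + 1))
    exact e1.exp.mul (h3.sub g3.hasDerivAt)
  have s3 := left_deriv_nonneg d3 (by
    filter_upwards [Ioo_mem_nhdsLT (show t - δ < t by linarith)] with σ hσ
    exact hmax x ⟨by linarith, by linarith⟩ σ ⟨hσ.1, hσ.2.le⟩)
  have s4 : 0 ≤ -(M + 1) * (φ x t - u x t) + (φt - pdt u x t) := by
    have : 0 ≤ Real.exp (-(M + 1) * t) * (-(M + 1) * (φ x t - u x t) + (φt - pdt u x t)) := by
      linarith
    exact nonneg_of_mul_nonneg_right this (Real.exp_pos _)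
  have s5 := hsub α β κ ha ha' hb hc
  have hα : 0 ≤ α := le_trans (by positivity) ha
  have s6 : α * (φxx - pdxx u x t) ≤ 0 := mul_nonpos_of_nonneg_of_nonpos hα s2
  have s7 : κ * (φ x t - u x t) ≤ M * (φ x t - u x t) :=
    mul_le_mul_of_nonneg_right ((le_abs_self κ).trans hc) hpos.le
  have s8 : pdx u x t = φx x := by linarith
  rw [s8] at he
  nlinarith

/-- weak maximum principle on compact sets -/
lemma weakMP {M : ℝ} (hM : 1 ≤ M) {u φ : ℝ → ℝ → ℝ} {K : Set (ℝ × ℝ)} (hK : IsCompact K)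
    (hu : ContinuousOn (fun p : ℝ × ℝ => u p.1 p.2) K)
    (hφ : ContinuousOn (fun p : ℝ × ℝ => φ p.1 p.2) K)
    (φx φxx φt : ℝ → ℝ → ℝ)
    (h1 : ∀ y t, HasDerivAt (fun y => φ y t) (φx y t) y)
    (h2 : ∀ y t, HasDerivAt (fun y => φx y t) (φxx y t) y)
    (h3 : ∀ y t, HasDerivAt (fun σ => φ y σ) (φt y t) t)
    (hsub : ∀ y t, ∀ α β κ : ℝ, M⁻¹ ≤ α → α ≤ M → |β| ≤ M → |κ| ≤ M →
      φt y t ≤ α * φxx y t + β * φx y t + κ * φ y t)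
    (hbd : ∀ p ∈ K, φ p.1 p.2 ≤ u p.1 p.2 ∨ (PD M u p.1 p.2 ∧
      ∃ δ > 0, ∀ x' ∈ Ioo (p.1 - δ) (p.1 + δ), ∀ τ ∈ Ioc (p.2 - δ) p.2, (x', τ) ∈ K)) :
    ∀ p ∈ K, φ p.1 p.2 ≤ u p.1 p.2 := by
  by_contra hcon
  push Not at hcon
  obtain ⟨q, hq, hq'⟩ := hcon
  have hc : ContinuousOn
      (fun p : ℝ × ℝ => Real.exp (-(M + 1) * p.2) * (φ p.1 p.2 - u p.1 p.2)) K := by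
    refine ContinuousOn.mul (Continuous.continuousOn (by fun_prop)) (hφ.sub hu)
  obtain ⟨p, hp, hmax⟩ := hK.exists_isMaxOn ⟨q, hq⟩ hc
  have hpos : 0 < φ p.1 p.2 - u p.1 p.2 := by
    have h4 : 0 < Real.exp (-(M + 1) * q.2) * (φ q.1 q.2 - u q.1 q.2) :=
      mul_pos (Real.exp_pos _) (by linarith)
    have h5 := isMaxOn_iff.1 hmax q hq
    exact pos_of_mul_pos_right (h4.trans_le h5) (Real.exp_pos _).le
  rcases hbd p hp with h | ⟨hPD, δ, hδ, hin⟩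
  · linarith
  · refine core hPD (fun y => φx y p.2) _ _ (fun y => h1 y p.2) (h2 p.1 p.2) (h3 p.1 p.2) hM
      (hsub p.1 p.2) hpos ⟨δ, hδ, fun x' hx' τ hτ => ?_⟩
    exact hmax (hin x' hx' τ hτ)

lemma weakMP0 {M : ℝ} (hM : 1 ≤ M) {u : ℝ → ℝ → ℝ} {K : Set (ℝ × ℝ)} (hK : IsCompact K)
    (hu : ContinuousOn (fun p : ℝ × ℝ => u p.1 p.2) K)
    (hbd : ∀ p ∈ K, 0 ≤ u p.1 p.2 ∨ (PD M u p.1 p.2 ∧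
      ∃ δ > 0, ∀ x' ∈ Ioo (p.1 - δ) (p.1 + δ), ∀ τ ∈ Ioc (p.2 - δ) p.2, (x', τ) ∈ K)) :
    ∀ p ∈ K, 0 ≤ u p.1 p.2 := by
  refine weakMP (φ := fun _ _ => 0) hM hK hu continuousOn_const (fun _ _ => 0) (fun _ _ => 0)
    (fun _ _ => 0) (fun _ _ => hasDerivAt_const _ _) (fun _ _ => hasDerivAt_const _ _)
    (fun _ _ => hasDerivAt_const _ _) ?_ hbd
  intros; simp

lemma barrier_ineq {M l E1 E2 E3 α β κ : ℝ} (_hM : 1 ≤ M) (hl : 0 ≤ l) (h1 : 0 ≤ E1) (h2 : 0 ≤ E2)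
    (h3 : 0 ≤ E3) (ha : M⁻¹ ≤ α) (ha' : α ≤ M) (hb : |β| ≤ M) (hc : |κ| ≤ M) :
    (l ^ 2 * M⁻¹ - M * l - M) * E1 - M * E2 - (M * l ^ 2 + M * l + M) * E3 ≤
      α * (l ^ 2 * E1 - l ^ 2 * E3) + β * (l * E1 + l * E3) + κ * (E1 - E2 - E3) := by
  obtain ⟨b1, b2⟩ := abs_le.1 hb
  obtain ⟨c1, c2⟩ := abs_le.1 hc
  have a1 : l ^ 2 * M⁻¹ ≤ α * l ^ 2 := by rw [mul_comm]; gcongr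
  have a2 : α * l ^ 2 ≤ M * l ^ 2 := by gcongr
  have b3 : -M * l ≤ β * l := by gcongr
  have b4 : β * l ≤ M * l := by gcongr
  have k1 : (l ^ 2 * M⁻¹ - M * l - M) * E1 ≤ (α * l ^ 2 + β * l + κ) * E1 := by
    apply mul_le_mul_of_nonneg_right _ h1; linarith
  have k2 : κ * E2 ≤ M * E2 := by gcongr
  have k3 : (α * l ^ 2 - β * l + κ) * E3 ≤ (M * l ^ 2 + M * l + M) * E3 := by
    apply mul_le_mul_of_nonneg_right _ h3; linarith
  linarith

lemma barrier_small {M h D m K : ℝ} (hM : 1 ≤ M) (hh : 0 < h) (hD : (2 + 2 * M ^ 2) * h ≤ D)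
    (hm : 0 < m) (hK : 0 < K) :
    ∃ ε > 0, ∀ τ ∈ Ioo 0 ε, ∃ l ≥ 0, 0 ≤ l ^ 2 * M⁻¹ - M * l - M ∧
      0 < m * Real.exp (-(l * h)) -
        m * Real.exp (-((l ^ 2 * M⁻¹ - M * l - M) * τ)) * Real.exp (M * τ)
        - K * Real.exp (-l * D + (M * l ^ 2 + M * l + M) * τ) := by
  set N := 2 * M * h with hN
  have hM0 : 0 < M := by linarith
  have hNp : 0 < N := by positivity
  set Q := Real.exp (M * N + 2 * M) with hQ
  have hQp : 0 < Q := Real.exp_pos _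
  refine ⟨min 1 (min (N ^ 2 * M⁻¹ / (M * N + M)) (N * h / (Q * (1 + K / m)))), by positivity, ?_⟩
  rintro τ ⟨hτ, hτ'⟩
  rw [lt_min_iff, lt_min_iff] at hτ'
  obtain ⟨t1, t2, t3⟩ := hτ'
  rw [lt_div_iff₀ (by positivity)] at t2 t3
  have hl0 : N / τ * τ = N := by field_simp
  have hmu : ((N / τ) ^ 2 * M⁻¹ - M * (N / τ) - M) * τ = N ^ 2 * M⁻¹ / τ - M * N - M * τ := by
    field_simp
  have hN2 : N ^ 2 * M⁻¹ = 2 * (N * h) := by rw [hN]; field_simp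
  refine ⟨N / τ, by positivity, ?_, ?_⟩
  · have : 0 ≤ ((N / τ) ^ 2 * M⁻¹ - M * (N / τ) - M) * τ := by
      rw [hmu]
      have : M * N + M ≤ N ^ 2 * M⁻¹ / τ := by
        rw [le_div_iff₀ hτ]; linarith
      nlinarith
    exact nonneg_of_mul_nonneg_left this hτ
  · have hrho : Real.exp (-(N * h / τ)) ≤ τ / (N * h) := by
      rw [Real.exp_neg, ← inv_div (N * h) τ]
      apply inv_anti₀ (by positivity)
      have := Real.add_one_le_exp (N * h / τ)
      linarith
    have e1 : Real.exp (-((( N / τ) ^ 2 * M⁻¹ - M * (N / τ) - M) * τ)) * Real.exp (M * τ)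
        ≤ Real.exp (-(N / τ * h)) * (Q * Real.exp (-(N * h / τ))) := by
      rw [hQ, ← Real.exp_add, ← Real.exp_add, ← Real.exp_add]
      apply Real.exp_le_exp.2
      rw [hmu, hN2]
      have : 2 * (N * h) / τ = N / τ * h + N * h / τ := by ring
      rw [this]
      nlinarith
    have e2 : Real.exp (-(N / τ) * D + (M * (N / τ) ^ 2 + M * (N / τ) + M) * τ)
        ≤ Real.exp (-(N / τ * h)) * (Q * Real.exp (-(N * h / τ))) := by
      rw [hQ, ← Real.exp_add, ← Real.exp_add]
      apply Real.exp_le_exp.2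
      have x1 : (M * (N / τ) ^ 2 + M * (N / τ) + M) * τ = N / τ * (M * N) + M * N + M * τ := by
        field_simp
      have x2 : N / τ * ((2 + 2 * M ^ 2) * h) ≤ N / τ * D := by gcongr
      have x3 : N / τ * ((2 + 2 * M ^ 2) * h) = 2 * (N / τ * h) + N / τ * (M * N) := by
        rw [hN]; ring
      have x4 : N * h / τ = N / τ * h := by ring
      rw [x1, x4]
      nlinarith
    have e3 : (m + K) * (Q * Real.exp (-(N * h / τ))) < m := by
      have y1 : (m + K) * (Q * Real.exp (-(N * h / τ))) ≤ (m + K) * (Q * (τ / (N * h))) := by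
        gcongr
      have y2 : (m + K) * (Q * (τ / (N * h))) = m * (τ * (Q * (1 + K / m))) / (N * h) := by
        field_simp
      have y3 : m * (τ * (Q * (1 + K / m))) / (N * h) < m := by
        rw [div_lt_iff₀ (by positivity)]
        exact mul_lt_mul_of_pos_left t3 hm
      linarith
    have e4 := mul_lt_mul_of_pos_left e3 (Real.exp_pos (-(N / τ * h)))
    have e5 := mul_le_mul_of_nonneg_left e1 hm.le
    have e6 := mul_le_mul_of_nonneg_left e2 hK.le
    nlinarith

lemma BL {M mid x2 R t0 τ0 : ℝ} {u : ℝ → ℝ → ℝ} (hM : 1 ≤ M) (hmid : mid < x2) (hR : x2 < R)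
    (hτ0 : 0 < τ0)
    (hu : ContinuousOn (fun p : ℝ × ℝ => u p.1 p.2) (Icc mid R ×ˢ Icc (t0 - τ0) t0))
    (hPD : ∀ x ∈ Ioo mid R, ∀ t ∈ Ioc (t0 - τ0) t0, PD M u x t)
    (hz : u x2 t0 ≤ 0) (hp : ∀ r ∈ Ioo x2 R, 0 < u r t0)
    (hsl : ∀ ε > 0, ∃ τ ∈ Ioo 0 ε, ∀ x ∈ Icc mid R, 0 ≤ u x (t0 - τ)) : False := by
  obtain ⟨K, hK⟩ := (isCompact_Icc.prod isCompact_Icc).exists_bound_of_continuousOn hu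
  have hMp : 0 < 2 + 2 * M ^ 2 := by positivity
  obtain ⟨h, hh, hh1, hh2⟩ : ∃ h > 0, (2 + 2 * M ^ 2) * h ≤ x2 - mid ∧ x2 + h < R := by
    refine ⟨min ((x2 - mid) / (2 + 2 * M ^ 2)) ((R - x2) / 2), ?_, ?_, ?_⟩
    · apply lt_min
      · apply div_pos <;> linarith
      · linarith
    · have := min_le_left ((x2 - mid) / (2 + 2 * M ^ 2)) ((R - x2) / 2)
      rw [le_div_iff₀ hMp] at this
      linarith
    · have := min_le_right ((x2 - mid) / (2 + 2 * M ^ 2)) ((R - x2) / 2)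
      linarith
  set r1 := x2 + h with hr1
  have hr1pos : 0 < u r1 t0 := hp r1 ⟨by linarith, hh2⟩
  set m := u r1 t0 / 2 with hm
  have hmpos : 0 < m := by positivity
  have hcr : ContinuousWithinAt (fun σ => u r1 σ) (Icc (t0 - τ0) t0) t0 := by
    have h1 : ContinuousOn (fun σ => u r1 σ) (Icc (t0 - τ0) t0) :=
      hu.comp (f := fun σ => (r1, σ)) (by fun_prop)
        (fun σ hσ => ⟨⟨by simp; linarith, by simp; linarith⟩, hσ⟩)
    exact h1 t0 ⟨by linarith, le_rfl⟩
  have hev : ∀ᶠ σ in 𝓝[Icc (t0 - τ0) t0] t0, m < u r1 σ :=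
    hcr.eventually (lt_mem_nhds (by linarith))
  rw [eventually_nhdsWithin_iff, Metric.eventually_nhds_iff] at hev
  obtain ⟨ε1, hε1, hev⟩ := hev
  have hKp : 0 < |K| + m := by positivity
  obtain ⟨ε2, hε2, hbar⟩ := barrier_small hM hh hh1 hmpos hKp
  obtain ⟨τ, ⟨hτ, hττ⟩, hslice⟩ := hsl (min ε2 (min ε1 τ0)) (by positivity)
  rw [lt_min_iff, lt_min_iff] at hττ
  obtain ⟨l, hl, hμ, hfin⟩ := hbar τ ⟨hτ, hττ.1⟩
  set μ := l ^ 2 * M⁻¹ - M * l - M with hμdef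
  set Λ := M * l ^ 2 + M * l + M with hΛdef
  have hΛ : 0 ≤ Λ := by positivity
  set t1 := t0 - τ with ht1
  have key := weakMP (M := M) (u := u)
    (φ := fun x σ => m * Real.exp (l * (x - r1) + μ * (σ - t0))
      - m * Real.exp (-(μ * τ)) * Real.exp (M * (σ - t1))
      - (|K| + m) * Real.exp (-l * (x - mid) + Λ * (σ - t1))) (K := Icc mid r1 ×ˢ Icc t1 t0)
    hM (isCompact_Icc.prod isCompact_Icc)
    (hu.mono (prod_mono (Icc_subset_Icc_right (by linarith)) (Icc_subset_Icc_left (by linarith))))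
    (Continuous.continuousOn (by fun_prop))
    (fun x σ => l * (m * Real.exp (l * (x - r1) + μ * (σ - t0)))
      + l * ((|K| + m) * Real.exp (-l * (x - mid) + Λ * (σ - t1))))
    (fun x σ => l ^ 2 * (m * Real.exp (l * (x - r1) + μ * (σ - t0)))
      - l ^ 2 * ((|K| + m) * Real.exp (-l * (x - mid) + Λ * (σ - t1))))
    (fun x σ => μ * (m * Real.exp (l * (x - r1) + μ * (σ - t0)))
      - M * (m * Real.exp (-(μ * τ)) * Real.exp (M * (σ - t1)))
      - Λ * ((|K| + m) * Real.exp (-l * (x - mid) + Λ * (σ - t1))))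
    ?_ ?_ ?_ ?_ ?_ (x2, t0) ⟨⟨hmid.le, by simp; linarith⟩, ⟨by simp; linarith, le_rfl⟩⟩
  · simp only at key
    have e1 : l * (x2 - r1) + μ * (t0 - t0) = -(l * h) := by rw [hr1]; ring
    have e2 : t0 - t1 = τ := by rw [ht1]; ring
    rw [e1, e2] at key
    linarith
  · intro y t
    have a1 : HasDerivAt (fun y : ℝ => l * (y - r1) + μ * (t - t0)) l y := by
      simpa using (((hasDerivAt_id y).sub_const r1).const_mul l).add_const (μ * (t - t0))
    have a2 : HasDerivAt (fun y : ℝ => -l * (y - mid) + Λ * (t - t1)) (-l) y := by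
      simpa using (((hasDerivAt_id y).sub_const mid).const_mul (-l)).add_const (Λ * (t - t1))
    refine (((a1.exp.const_mul m).sub_const _).sub (a2.exp.const_mul (|K| + m))).congr_deriv ?_
    ring
  · intro y t
    have a1 : HasDerivAt (fun y : ℝ => l * (y - r1) + μ * (t - t0)) l y := by
      simpa using (((hasDerivAt_id y).sub_const r1).const_mul l).add_const (μ * (t - t0))
    have a2 : HasDerivAt (fun y : ℝ => -l * (y - mid) + Λ * (t - t1)) (-l) y := by
      simpa using (((hasDerivAt_id y).sub_const mid).const_mul (-l)).add_const (Λ * (t - t1))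
    refine (((a1.exp.const_mul m).const_mul l).add
      ((a2.exp.const_mul (|K| + m)).const_mul l)).congr_deriv ?_
    ring
  · intro y t
    have a1 : HasDerivAt (fun t : ℝ => l * (y - r1) + μ * (t - t0)) μ t := by
      simpa using (((hasDerivAt_id t).sub_const t0).const_mul μ).const_add (l * (y - r1))
    have a2 : HasDerivAt (fun t : ℝ => -l * (y - mid) + Λ * (t - t1)) Λ t := by
      simpa using (((hasDerivAt_id t).sub_const t1).const_mul Λ).const_add (-l * (y - mid))
    have a3 : HasDerivAt (fun t : ℝ => M * (t - t1)) M t := by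
      simpa using (((hasDerivAt_id t).sub_const t1).const_mul M)
    refine (((a1.exp.const_mul m).sub (a3.exp.const_mul (m * Real.exp (-(μ * τ))))).sub
      (a2.exp.const_mul (|K| + m))).congr_deriv ?_
    ring
  · intro y t α β κ q1 q2 q3 q4
    exact barrier_ineq hM hl (by positivity) (by positivity) (by positivity) q1 q2 q3 q4
  · rintro ⟨x, σ⟩ ⟨⟨hx1, hx2⟩, ⟨hσ1, hσ2⟩⟩
    simp only at hx1 hx2 hσ1 hσ2 ⊢
    have T1 : m * Real.exp (l * (x - r1) + μ * (σ - t0)) ≤ m := by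
      have : Real.exp (l * (x - r1) + μ * (σ - t0)) ≤ 1 := by
        rw [Real.exp_le_one_iff]
        have := mul_nonneg hl (sub_nonneg.2 hx2)
        have := mul_nonneg hμ (sub_nonneg.2 hσ2)
        linarith
      nlinarith
    have T2 : 0 ≤ m * Real.exp (-(μ * τ)) * Real.exp (M * (σ - t1)) := by positivity
    have T3 : 0 ≤ (|K| + m) * Real.exp (-l * (x - mid) + Λ * (σ - t1)) := by positivity
    rcases hσ1.eq_or_lt with rfl | hσ1'
    · left
      have := hslice x ⟨hx1, by linarith⟩
      refine le_trans ?_ this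
      have : Real.exp (l * (x - r1) + μ * (t1 - t0)) ≤ Real.exp (-(μ * τ)) := by
        rw [Real.exp_le_exp]
        have := mul_nonneg hl (sub_nonneg.2 hx2)
        rw [ht1]; linarith
      have := mul_le_mul_of_nonneg_left this hmpos.le
      simp only [sub_self, mul_zero, Real.exp_zero, mul_one] at *
      linarith
    rcases hx1.eq_or_lt with rfl | hx1'
    · left
      have b1 := hK (mid, σ) ⟨⟨by simp, by simp; linarith⟩, ⟨by simp; linarith, hσ2⟩⟩
      simp only [Real.norm_eq_abs] at b1
      have b2 := (abs_le.1 (b1.trans (le_abs_self K))).1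
      have : 1 ≤ Real.exp (-l * (mid - mid) + Λ * (σ - t1)) := by
        rw [Real.one_le_exp_iff]
        have := mul_nonneg hΛ (sub_nonneg.2 hσ1)
        simpa using this
      have := mul_le_mul_of_nonneg_left this hKp.le
      linarith
    rcases hx2.eq_or_lt with rfl | hx2'
    · left
      have := hev (y := σ) (by rw [Real.dist_eq, abs_lt]; constructor <;> linarith)
        ⟨by linarith, hσ2⟩
      linarith
    · right
      refine ⟨hPD x ⟨hx1', by linarith⟩ σ ⟨by linarith, hσ2⟩, min (σ - t1) (min (x - mid) (r1 - x)),
        ?_, ?_⟩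
      · simp only [gt_iff_lt, lt_min_iff]; refine ⟨?_, ?_, ?_⟩ <;> linarith
      · rintro x' ⟨h1, h2⟩ τ' ⟨h3, h4⟩
        have c1 := min_le_left (σ - t1) (min (x - mid) (r1 - x))
        have c2 := min_le_right (σ - t1) (min (x - mid) (r1 - x))
        have c3 := min_le_left (x - mid) (r1 - x)
        have c4 := min_le_right (x - mid) (r1 - x)
        exact ⟨⟨by simp; linarith, by simp; linarith⟩, ⟨by simp; linarith, by simp; linarith⟩⟩

def IsBP (w : ℝ → ℝ → ℝ) (L R t y τ : ℝ) (γ : ℝ → ℝ) : Prop :=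
  ContinuousOn γ (Icc τ t) ∧ γ t = y ∧ ∀ σ ∈ Icc τ t, γ σ ∈ Icc L R ∧ 0 < w (γ σ) σ

lemma bp_ext {w : ℝ → ℝ → ℝ} {L R s t y τ τ' x' : ℝ} {γ : ℝ → ℝ} {p : ℝ × ℝ} {δ : ℝ}
    (hγ : IsBP w L R t y τ γ) (hτt : τ ≤ t)
    (hbox : ∀ x ∈ Icc L R, ∀ σ ∈ Icc s t, |x - p.1| < δ → |σ - p.2| < δ → 0 < w x σ)
    (hq1 : |γ τ - p.1| < δ) (hq2 : |τ - p.2| < δ) (hx' : x' ∈ Icc L R) (hx'' : |x' - p.1| < δ)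
    (hτ' : s ≤ τ') (hτ'' : |τ' - p.2| < δ) (hlt : τ' < τ) :
    ∃ γ', IsBP w L R t y τ' γ' ∧ γ' τ' = x' := by
  obtain ⟨hc, hy, hin⟩ := hγ
  set ln : ℝ → ℝ := fun σ => x' + (σ - τ') / (τ - τ') * (γ τ - x') with hln
  have hd : 0 < τ - τ' := by linarith
  have hlτ : ln τ = γ τ := by simp only [hln]; field_simp; ring
  have hlτ' : ln τ' = x' := by simp [hln]
  have e1 : EqOn (fun σ => if σ ≤ τ then ln σ else γ σ) ln (Icc τ' τ) := by
    intro σ hσ; simp [hσ.2]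
  have e2 : EqOn (fun σ => if σ ≤ τ then ln σ else γ σ) γ (Icc τ t) := by
    intro σ hσ
    rcases hσ.1.eq_or_lt with rfl | h
    · simp [hlτ]
    · simp [not_le.2 h]
  have hun : Icc τ' τ ∪ Icc τ t = Icc τ' t := Icc_union_Icc_eq_Icc hlt.le hτt
  refine ⟨fun σ => if σ ≤ τ then ln σ else γ σ, ⟨?_, ?_, ?_⟩, ?_⟩
  · rw [← hun]
    refine ContinuousOn.union_of_isClosed ?_ ?_ isClosed_Icc isClosed_Icc
    · refine ContinuousOn.congr (Continuous.continuousOn ?_) e1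
      simp only [hln]; fun_prop
    · exact hc.congr e2
  · rw [← hy]; exact e2 ⟨hτt, le_rfl⟩
  · intro σ hσ
    rw [← hun] at hσ
    rcases hσ with hσ | hσ
    · have he : (if σ ≤ τ then ln σ else γ σ) = ln σ := e1 hσ
      simp only [he]
      have hγτ := (hin τ ⟨le_rfl, hτt⟩).1
      set θ := (σ - τ') / (τ - τ') with hθ
      have hθ0 : 0 ≤ θ := div_nonneg (by linarith [hσ.1]) hd.le
      have hθ1 : θ ≤ 1 := by rw [hθ, div_le_one hd]; linarith [hσ.2]
      have hl : ln σ = (1 - θ) * x' + θ * γ τ := by simp only [hln]; ring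
      have hmem : ln σ ∈ Icc L R := by
        rw [hl]
        exact convex_Icc L R hx' hγτ (by linarith) hθ0 (by ring)
      have habs : ln σ ∈ Ioo (p.1 - δ) (p.1 + δ) := by
        rw [hl]
        rw [abs_lt] at hx'' hq1
        exact convex_Ioo (p.1 - δ) (p.1 + δ) (x := x') (y := γ τ)
          ⟨by linarith, by linarith⟩ ⟨by linarith, by linarith⟩ (by linarith) hθ0 (by ring)
      refine ⟨hmem, hbox _ hmem σ ⟨by linarith [hσ.1], by linarith [hσ.2]⟩ ?_ ?_⟩
      · rw [abs_lt]; constructor <;> linarith [habs.1, habs.2]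
      · rw [abs_lt] at *; constructor <;> linarith [hσ.1, hσ.2]
    · have he : (if σ ≤ τ then ln σ else γ σ) = γ σ := e2 hσ
      simp only [he]
      exact hin σ hσ
  · simp [hlt.le, hlτ']

lemma reach {L R s t y : ℝ} {w : ℝ → ℝ → ℝ} (hst : s ≤ t)
    (hw : ContinuousOn (fun p : ℝ × ℝ => w p.1 p.2) (Icc L R ×ˢ Icc s t))
    (hN : ∀ x ∈ Ioo L R, ∀ τ ∈ Ioc s t, 0 < w x τ →
      ¬ ∃ δ > 0, ∀ x' ∈ Ioo (x - δ) (x + δ), ∀ τ' ∈ Ioc (τ - δ) τ, w x' τ' ≤ w x τ)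
    (hy : y ∈ Icc L R) (hpos : 0 < w y t) :
    ∃ τ ∈ Icc s t, ∃ γ, IsBP w L R t y τ γ ∧ (τ = s ∨ γ τ = L ∨ γ τ = R) := by
  set S : Set (ℝ × ℝ) := {p | p.2 ∈ Icc s t ∧ ∃ γ, IsBP w L R t y p.2 γ ∧ γ p.2 = p.1} with hS
  have hSsub : S ⊆ Icc L R ×ˢ Icc s t := by
    rintro p ⟨h1, γ, h2, h3⟩
    refine ⟨?_, h1⟩
    rw [← h3]
    exact (h2.2.2 _ ⟨le_rfl, h1.2⟩).1
  have hclos : closure S ⊆ Icc L R ×ˢ Icc s t :=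
    closure_minimal hSsub (isClosed_Icc.prod isClosed_Icc)
  have hcomp : IsCompact (closure S) :=
    (isCompact_Icc.prod isCompact_Icc).of_isClosed_subset isClosed_closure hclos
  have hyS : (y, t) ∈ S := by
    refine ⟨⟨hst, le_rfl⟩, fun _ => y, ⟨continuousOn_const, rfl, ?_⟩, rfl⟩
    intro σ hσ
    have : σ = t := le_antisymm hσ.2 hσ.1
    subst this
    exact ⟨hy, hpos⟩
  obtain ⟨p, hp, hmax⟩ := hcomp.exists_isMaxOn ⟨_, subset_closure hyS⟩ (hw.mono hclos)
  rw [isMaxOn_iff] at hmax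
  have hppos : 0 < w p.1 p.2 := lt_of_lt_of_le hpos (hmax _ (subset_closure hyS))
  obtain ⟨⟨hpL, hpR⟩, hps, hpt⟩ := hclos hp
  obtain ⟨δ, hδ, hbox⟩ : ∃ δ > 0, ∀ x ∈ Icc L R, ∀ σ ∈ Icc s t, |x - p.1| < δ → |σ - p.2| < δ →
      0 < w x σ := by
    have h1 := (hw p (hclos hp)).eventually (lt_mem_nhds hppos)
    rw [eventually_nhdsWithin_iff, Metric.eventually_nhds_iff] at h1
    obtain ⟨δ, hδ, h1⟩ := h1
    refine ⟨δ, hδ, fun x hx σ hσ h2 h3 => ?_⟩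
    refine h1 (y := (x, σ)) ?_ ⟨hx, hσ⟩
    rw [Prod.dist_eq]
    exact max_lt h2 h3
  have hnear : ∀ η > 0, ∃ τ ∈ Icc s t, ∃ γ, IsBP w L R t y τ γ ∧ |γ τ - p.1| < η ∧
      |τ - p.2| < η := by
    intro η hη
    obtain ⟨q, ⟨hq1, γ, hγ, hq2⟩, hd⟩ := Metric.mem_closure_iff.1 hp η hη
    rw [dist_comm, Prod.dist_eq] at hd
    refine ⟨q.2, hq1, γ, hγ, ?_, ?_⟩
    · rw [hq2]; exact (le_max_left _ _).trans_lt hd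
    · exact (le_max_right _ _).trans_lt hd
  have hpe : |p.1 - p.1| < δ := by simpa using hδ
  rcases hps.eq_or_lt with hs' | hs'
  · obtain ⟨τ, hτ, γ, hγ, h1, h2⟩ := hnear δ hδ
    rcases hτ.1.eq_or_lt with h | h
    · exact ⟨τ, hτ, γ, hγ, Or.inl h.symm⟩
    · obtain ⟨γ', hγ', -⟩ := bp_ext (s := s) (τ' := s) (x' := p.1) hγ hτ.2 hbox h1 h2 ⟨hpL, hpR⟩ hpe
        le_rfl (by rw [← hs']; simpa using hδ) h
      exact ⟨s, ⟨le_rfl, hst⟩, γ', hγ', Or.inl rfl⟩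
  by_cases hside : p.1 = L ∨ p.1 = R
  · obtain ⟨τ, hτ, γ, hγ, h1, h2⟩ := hnear (min δ (p.2 - s)) (lt_min hδ (by linarith))
    have h1' := h1.trans_le (min_le_left _ _)
    have h2' := h2.trans_le (min_le_left _ _)
    have h2'' := h2.trans_le (min_le_right _ _)
    have h3 : s < τ := by rw [abs_lt] at h2''; linarith
    have h4 : p.2 - δ < τ := by rw [abs_lt] at h2'; linarith
    have h5 : τ < p.2 + δ := by rw [abs_lt] at h2'; linarith
    obtain ⟨τ', h6, h7⟩ := exists_between (max_lt h3 h4)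
    have h8 := (le_max_left s (p.2 - δ)).trans h6.le
    have h9 := (le_max_right s (p.2 - δ)).trans_lt h6
    obtain ⟨γ', hγ', he⟩ := bp_ext (s := s) (τ' := τ') (x' := p.1) hγ hτ.2 hbox h1' h2'
      ⟨hpL, hpR⟩ hpe h8 (by rw [abs_lt]; constructor <;> linarith) h7
    refine ⟨τ', ⟨h8, by linarith [hτ.2]⟩, γ', hγ', Or.inr ?_⟩
    rw [he]; exact hside
  · exfalso
    push Not at hside
    have hL' : L < p.1 := lt_of_le_of_ne hpL (Ne.symm hside.1)
    have hR' : p.1 < R := lt_of_le_of_ne hpR hside.2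
    refine hN p.1 ⟨hL', hR'⟩ p.2 ⟨hs', hpt⟩ hppos ⟨min (min δ (p.2 - s)) (min (p.1 - L) (R - p.1)),
      ?_, ?_⟩
    · simp only [gt_iff_lt, lt_min_iff]; refine ⟨⟨?_, ?_⟩, ?_, ?_⟩ <;> linarith
    set δ' := min (min δ (p.2 - s)) (min (p.1 - L) (R - p.1)) with hδ'
    have c1 : δ' ≤ δ := (min_le_left _ _).trans (min_le_left _ _)
    have c2 : δ' ≤ p.2 - s := (min_le_left _ _).trans (min_le_right _ _)
    have c3 : δ' ≤ p.1 - L := (min_le_right _ _).trans (min_le_left _ _)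
    have c4 : δ' ≤ R - p.1 := (min_le_right _ _).trans (min_le_right _ _)
    intro x' hx' τ' hτ'
    have main : ∀ τ' ∈ Ioo (p.2 - δ') p.2, (x', τ') ∈ S := by
      intro τ' hτ'
      obtain ⟨τ, hτ, γ, hγ, h1, h2⟩ := hnear (min δ (p.2 - τ')) (lt_min hδ (by linarith [hτ'.2]))
      have h2' := h2.trans_le (min_le_right _ _)
      rw [abs_lt] at h2'
      have h8 : s ≤ τ' := by linarith [hτ'.1]
      have h9 : τ' < τ := by linarith
      refine ⟨⟨h8, by show τ' ≤ t; linarith [hτ.2]⟩, ?_⟩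
      exact bp_ext (s := s) (τ' := τ') (x' := x') hγ hτ.2 hbox (h1.trans_le (min_le_left _ _))
        (h2.trans_le (min_le_left _ _)) ⟨by linarith [hx'.1], by linarith [hx'.2]⟩
        (by rw [abs_lt]; constructor <;> linarith [hx'.1, hx'.2]) h8
        (by rw [abs_lt]; constructor <;> linarith [hτ'.1, hτ'.2]) h9
    have hcl : (x', τ') ∈ closure S := by
      rcases hτ'.2.eq_or_lt with h | h
      · have ht : Tendsto (fun σ : ℝ => (x', σ)) (𝓝[<] p.2) (𝓝 (x', p.2)) := by
          apply tendsto_nhdsWithin_of_tendsto_nhds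
          exact (Continuous.prodMk continuous_const continuous_id).tendsto _
        rw [h]
        refine mem_closure_of_tendsto ht ?_
        have hlt : p.2 - δ' < p.2 := by linarith [hx'.1, hx'.2]
        filter_upwards [Ioo_mem_nhdsLT hlt] with σ hσ
        exact main σ hσ
      · exact subset_closure (main τ' ⟨hτ'.1, h⟩)
    exact hmax _ hcl

/-- the positivity set of solution is backward path-connected to the parabolic boundary -/
lemma reachPD {M L R s t y : ℝ} {u : ℝ → ℝ → ℝ} (hM : 1 ≤ M) (hst : s ≤ t)
    (hu : ContinuousOn (fun p : ℝ × ℝ => u p.1 p.2) (Icc L R ×ˢ Icc s t))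
    (hPD : ∀ x ∈ Ioo L R, ∀ τ ∈ Ioc s t, PD M u x τ)
    (hy : y ∈ Icc L R) (hpos : u y t < 0) :
    ∃ τ ∈ Icc s t, ∃ γ, IsBP (fun x t => -u x t) L R t y τ γ ∧ (τ = s ∨ γ τ = L ∨ γ τ = R) := by
  have hsgn : ∀ x σ, 0 < Real.exp (-(M + 1) * σ) * (0 - u x σ) ↔ 0 < - u x σ := by
    intro x σ
    rw [mul_pos_iff_of_pos_left (Real.exp_pos _), zero_sub]
  obtain ⟨τ, hτ, γ, ⟨h1, h2, h3⟩, h4⟩ := reach (y := y)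
      (w := fun x σ => Real.exp (-(M + 1) * σ) * (0 - u x σ)) hst
    (ContinuousOn.mul (Continuous.continuousOn (by fun_prop)) (continuousOn_const.sub hu))
    (by
      intro x hx τ hτ hp hmax
      refine core (φ := fun _ _ => 0) (hPD x hx τ hτ) (fun _ => 0) 0 0
        (fun _ => hasDerivAt_const _ _) (hasDerivAt_const _ _) (hasDerivAt_const _ _) hM ?_ ?_ hmax
      · intros; simp
      · have := (hsgn x τ).1 hp
        simpa using this)
    hy ((hsgn _ _).2 (by linarith))
  exact ⟨τ, hτ, γ, ⟨h1, h2, fun σ hσ => ⟨(h3 σ hσ).1, (hsgn _ _).1 (h3 σ hσ).2⟩⟩, h4⟩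

lemma signStruct {M L R s t x0 y1 y2 : ℝ} {u : ℝ → ℝ → ℝ} (hM : 1 ≤ M) (hst : s ≤ t)
    (hu : ContinuousOn (fun p : ℝ × ℝ => u p.1 p.2) (Icc L R ×ˢ Icc s t))
    (hPD : ∀ x ∈ Ioo L R, ∀ τ ∈ Ioc s t, PD M u x τ)
    (hL : ∀ σ ∈ Icc s t, u L σ < 0) (hR : ∀ σ ∈ Icc s t, 0 < u R σ)
    (hs1 : ∀ x ∈ Icc L R, x ≤ x0 → u x s ≤ 0) (hs2 : ∀ x ∈ Icc L R, x0 ≤ x → 0 ≤ u x s)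
    (hy1 : y1 ∈ Icc L R) (hy2 : y2 ∈ Icc L R) (hy : y1 < y2) (h1 : 0 < u y1 t) (h2 : u y2 t < 0) :
    False := by
  obtain ⟨τm, hτm, γm, ⟨m1, m2, m3⟩, m4⟩ := reachPD hM hst hu hPD hy2 h2
  obtain ⟨τp, hτp, γp, ⟨p1, p2, p3⟩, p4⟩ := reachPD (u := fun x t => - u x t) hM hst hu.neg
    (fun x hx τ hτ => (hPD x hx τ hτ).neg) hy1 (by linarith)
  simp only [neg_neg] at p3
  have m4' : τm = s ∨ γm τm = L := by
    rcases m4 with h | h | h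
    · exact Or.inl h
    · exact Or.inr h
    · have a1 := (m3 τm ⟨le_rfl, hτm.2⟩).2
      rw [h] at a1
      have := hR τm hτm
      linarith
  have p4' : τp = s ∨ γp τp = R := by
    rcases p4 with h | h | h
    · exact Or.inl h
    · have a1 := (p3 τp ⟨le_rfl, hτp.2⟩).2
      rw [h] at a1
      have := hL τp hτp
      linarith
    · exact Or.inr h
  set τ := max τm τp with hτ
  have hτt : τ ≤ t := max_le hτm.2 hτp.2
  have b1 := m3 τ ⟨le_max_left _ _, hτt⟩
  have b2 := p3 τ ⟨le_max_right _ _, hτt⟩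
  have hge : γm τ ≤ γp τ := by
    rcases le_total τm τp with h | h
    · have e : τ = τp := max_eq_right h
      rcases p4' with h' | h'
      · have e' : τ = s := e.trans h'
        rw [e'] at b1 b2 ⊢
        by_contra hlt
        push Not at hlt
        rcases le_total (γp s) x0 with q | q
        · have := hs1 _ b2.1 q; linarith [b2.2]
        · have := hs2 _ b1.1 (by linarith); linarith [b1.2]
      · rw [e, h', ← e]; exact b1.1.2
    · have e : τ = τm := max_eq_left h
      rcases m4' with h' | h'
      · have e' : τ = s := e.trans h'
        rw [e'] at b1 b2 ⊢
        by_contra hlt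
        push Not at hlt
        rcases le_total (γp s) x0 with q | q
        · have := hs1 _ b2.1 q; linarith [b2.2]
        · have := hs2 _ b1.1 (by linarith); linarith [b1.2]
      · rw [e, h', ← e]; exact b2.1.1
  have hcont : ContinuousOn (fun σ => γp σ - γm σ) (Icc τ t) :=
    (p1.mono (Icc_subset_Icc_left (le_max_right _ _))).sub
      (m1.mono (Icc_subset_Icc_left (le_max_left _ _)))
  have hivt := intermediate_value_Icc' hτt hcont
  obtain ⟨σ, hσ, he⟩ := hivt (show (0 : ℝ) ∈ _ from ⟨by rw [p2, m2]; linarith, by linarith⟩)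
  have he' : γp σ = γm σ := by simp only at he; linarith
  have c1 := (m3 σ ⟨(le_max_left _ _).trans hσ.1, hσ.2⟩).2
  have c2 := (p3 σ ⟨(le_max_right _ _).trans hσ.1, hσ.2⟩).2
  rw [he'] at c2
  linarith

lemma constSign {f : ℝ → ℝ} {a b : ℝ} (hab : a ≤ b) (hf : ContinuousOn f (Icc a b))
    (hne : ∀ x ∈ Icc a b, f x ≠ 0) (hb : 0 < f b) : 0 < f a := by
  by_contra h
  push Not at h
  obtain ⟨x, hx, he⟩ := intermediate_value_Icc hab hf (show (0 : ℝ) ∈ _ from ⟨h, hb.le⟩)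
  exact hne x hx he

lemma lastZero {f : ℝ → ℝ} {z R : ℝ} (hzR : z ≤ R) (hf : ContinuousOn f (Icc z R)) (hz : f z = 0)
    (hR : 0 < f R) : ∃ x2, z ≤ x2 ∧ x2 < R ∧ f x2 = 0 ∧ ∀ r ∈ Ioo x2 R, 0 < f r := by
  have hcl : IsClosed (Icc z R ∩ f ⁻¹' {0}) :=
    hf.preimage_isClosed_of_isClosed isClosed_Icc isClosed_singleton
  have hcp : IsCompact (Icc z R ∩ f ⁻¹' {0}) :=
    isCompact_Icc.of_isClosed_subset hcl inter_subset_left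
  obtain ⟨x2, ⟨⟨h1, h2⟩, h3⟩, h4⟩ := hcp.exists_isGreatest ⟨z, ⟨le_rfl, hzR⟩, hz⟩
  have h3' : f x2 = 0 := h3
  refine ⟨x2, h1, lt_of_le_of_ne h2 (by rintro rfl; linarith), h3', fun r hr => ?_⟩
  refine constSign hr.2.le (hf.mono (Icc_subset_Icc_left (by linarith [hr.1]))) ?_ hR
  intro x hx hx0
  have := h4 ⟨⟨by linarith [hx.1, hr.1], hx.2⟩, hx0⟩
  linarith [hx.1, hr.1]

lemma slice_cont_s15 {u : ℝ → ℝ → ℝ} {A R s t t0 : ℝ}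
    (hu : ContinuousOn (fun p : ℝ × ℝ => u p.1 p.2) (Icc A R ×ˢ Icc s t)) (h : t0 ∈ Icc s t) :
    ContinuousOn (fun x => u x t0) (Icc A R) :=
  hu.comp (f := fun x => (x, t0)) (by fun_prop) (fun _ hx => ⟨hx, h⟩)

lemma slice_cont'_s15 {u : ℝ → ℝ → ℝ} {A R s t x : ℝ}
    (hu : ContinuousOn (fun p : ℝ × ℝ => u p.1 p.2) (Icc A R ×ˢ Icc s t)) (h : x ∈ Icc A R) :
    ContinuousOn (fun σ => u x σ) (Icc s t) :=
  hu.comp (f := fun σ => (x, σ)) (by fun_prop) (fun _ hx => ⟨h, hx⟩)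

lemma strongPos {M A R t0 τ0 : ℝ} {u : ℝ → ℝ → ℝ} (hM : 1 ≤ M)
    (hτ0 : 0 < τ0)
    (hu : ContinuousOn (fun p : ℝ × ℝ => u p.1 p.2) (Icc A R ×ˢ Icc (t0 - τ0) t0))
    (hPD : ∀ x ∈ Ioo A R, ∀ t ∈ Ioc (t0 - τ0) t0, PD M u x t)
    (hnn : ∀ x ∈ Icc A R, ∀ t ∈ Icc (t0 - τ0) t0, 0 ≤ u x t) (hR : 0 < u R t0) :
    ∀ x ∈ Ioo A R, u x t0 ≠ 0 := by
  intro z hz hz0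
  obtain ⟨x2, h1, h2, h3, h4⟩ := lastZero (f := fun x => u x t0) hz.2.le
    ((slice_cont_s15 hu ⟨by linarith, le_rfl⟩).mono (Icc_subset_Icc_left hz.1.le)) hz0 hR
  refine BL hM (lt_of_lt_of_le hz.1 h1) h2 hτ0 hu hPD h3.le h4 fun ε hε => ?_
  have hp : 0 < min ε τ0 := lt_min hε hτ0
  have := min_le_left ε τ0
  have := min_le_right ε τ0
  exact ⟨min ε τ0 / 2, ⟨by linarith, by linarith⟩, fun x hx => hnn x hx _
    ⟨by linarith, by linarith⟩⟩

lemma uniqZero {M L R s t0 x0 x x' : ℝ} {u : ℝ → ℝ → ℝ} (hM : 1 ≤ M) (hst : s < t0)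
    (hu : ContinuousOn (fun p : ℝ × ℝ => u p.1 p.2) (Icc L R ×ˢ Icc s t0))
    (hPD : ∀ x ∈ Ioo L R, ∀ τ ∈ Ioc s t0, PD M u x τ)
    (hL : ∀ σ ∈ Icc s t0, u L σ < 0) (hR : ∀ σ ∈ Icc s t0, 0 < u R σ)
    (hs1 : ∀ x ∈ Icc L R, x ≤ x0 → u x s ≤ 0) (hs2 : ∀ x ∈ Icc L R, x0 ≤ x → 0 ≤ u x s)
    (hx : x ∈ Ioo L R) (hx' : x' ∈ Ioo L R) (h1 : u x t0 = 0) (h2 : u x' t0 = 0) :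
    ¬ x < x' := by
  intro hlt
  set mid := (x + x') / 2 with hmid
  have ht0 : t0 ∈ Icc s t0 := ⟨hst.le, le_rfl⟩
  have eτ : t0 - (t0 - s) = s := by ring
  by_cases H : ∀ ε > 0, ∃ τ ∈ Ioo 0 ε, ∀ x ∈ Icc mid R, 0 ≤ u x (t0 - τ)
  · obtain ⟨x2, a1, a2, a3, a4⟩ := lastZero (f := fun x => u x t0) hx'.2.le
      ((slice_cont_s15 hu ht0).mono (Icc_subset_Icc_left hx'.1.le)) h2 (hR t0 ht0)
    refine BL (τ0 := t0 - s) hM (show mid < x2 by linarith) a2 (by linarith)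
      (hu.mono (prod_mono (Icc_subset_Icc_left (by linarith [hx.1])) (by rw [eτ]))) ?_ a3.le a4 H
    intro y hy t ht
    rw [eτ] at ht
    exact hPD y ⟨by linarith [hy.1, hx.1], hy.2⟩ t ht
  · push Not at H
    obtain ⟨ε, hε, H⟩ := H
    have hrc : ContinuousOn (fun p : ℝ × ℝ => - u (-p.1) p.2) (Icc (-R) (-L) ×ˢ Icc s t0) := by
      refine (hu.comp (f := fun p : ℝ × ℝ => (-p.1, p.2)) (by fun_prop) ?_).neg
      rintro p ⟨hp1, hp2⟩
      exact ⟨⟨by simp; linarith [hp1.2], by simp; linarith [hp1.1]⟩, hp2⟩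
    have hrs : ContinuousOn (fun x => - u (-x) t0) (Icc (-R) (-L)) :=
      slice_cont_s15 (u := fun x t => - u (-x) t) hrc ht0
    obtain ⟨x2, a1, a2, a3, a4⟩ := lastZero (f := fun x => - u (-x) t0)
      (show -x ≤ -L by linarith [hx.1])
      (hrs.mono (Icc_subset_Icc_left (by linarith [hx.2] : -R ≤ -x))) (by simp [h1])
      (by simpa using hL t0 ht0)
    refine BL (u := fun x t => - u (-x) t) (mid := -mid) (τ0 := t0 - s) hM
      (show -mid < x2 by linarith) a2 (by linarith)
      (hrc.mono (prod_mono (Icc_subset_Icc_left (by linarith [hx'.2])) (by rw [eτ]))) ?_ a3.le a4 ?_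
    · intro y hy t ht
      rw [eτ] at ht
      have := hPD (-y) ⟨by linarith [hy.2], by linarith [hy.1, hx'.2]⟩ t ht
      exact (PD.refl this).neg
    · intro ε' hε'
      have hp : 0 < min (min ε ε') (t0 - s) := lt_min (lt_min hε hε') (by linarith)
      have q1 : min (min ε ε') (t0 - s) ≤ ε := (min_le_left _ _).trans (min_le_left _ _)
      have q2 : min (min ε ε') (t0 - s) ≤ ε' := (min_le_left _ _).trans (min_le_right _ _)
      have q3 : min (min ε ε') (t0 - s) ≤ t0 - s := min_le_right _ _
      set τ := min (min ε ε') (t0 - s) / 2 with hτ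
      refine ⟨τ, ⟨by linarith, by linarith⟩, fun y hy => ?_⟩
      by_contra hneg
      push Not at hneg
      obtain ⟨z, hz, hz0⟩ := H τ ⟨by linarith, by linarith⟩
      have hne : -y ≠ z := by rintro rfl; linarith
      have hlt' : -y < z := lt_of_le_of_ne (by linarith [hy.1, hz.1]) hne
      have hsub : Icc s (t0 - τ) ⊆ Icc s t0 := Icc_subset_Icc_right (by linarith)
      exact signStruct (t := t0 - τ) (y1 := -y) (y2 := z) hM (by linarith)
        (hu.mono (prod_mono_right hsub))
        (fun x hx σ hσ => hPD x hx σ ⟨hσ.1, by linarith [hσ.2]⟩)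
        (fun σ hσ => hL σ (hsub hσ)) (fun σ hσ => hR σ (hsub hσ)) hs1 hs2
        ⟨by linarith [hy.2], by linarith [hy.1, hx'.2]⟩ ⟨by linarith [hz.1, hx.1], hz.2⟩ hlt'
        (by linarith) hz0

lemma compactD {ξ : ℝ → ℝ} {R s t : ℝ} (hξ : ContinuousOn ξ (Icc s t))
    (hle : ∀ σ ∈ Icc s t, ξ σ ≤ R) :
    IsCompact {p : ℝ × ℝ | p.2 ∈ Icc s t ∧ p.1 ∈ Icc (ξ p.2) R} := by
  have hc : ContinuousOn (fun p : ℝ × ℝ => (ξ p.2 + p.1 * (R - ξ p.2), p.2))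
      (Icc (0 : ℝ) 1 ×ˢ Icc s t) := by
    have h1 : ContinuousOn (fun p : ℝ × ℝ => ξ p.2) (Icc (0 : ℝ) 1 ×ˢ Icc s t) :=
      hξ.comp continuousOn_snd (fun p hp => hp.2)
    exact (h1.add (continuousOn_fst.mul (continuousOn_const.sub h1))).prodMk continuousOn_snd
  have := (isCompact_Icc.prod isCompact_Icc).image_of_continuousOn hc
  convert this using 1
  ext ⟨x, σ⟩
  constructor
  · rintro ⟨h1, h2, h3⟩
    simp only at h1 h2 h3
    rcases (hle σ h1).eq_or_lt with h | h
    · exact ⟨(0, σ), ⟨⟨le_rfl, zero_le_one⟩, h1⟩, by simp; linarith⟩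
    · have hd : 0 < R - ξ σ := by linarith
      refine ⟨((x - ξ σ) / (R - ξ σ), σ), ⟨⟨?_, ?_⟩, h1⟩, ?_⟩
      · exact div_nonneg (by linarith) hd.le
      · simp only; rw [div_le_one hd]; linarith
      · simp only [Prod.mk.injEq, and_true]; field_simp; ring
  · rintro ⟨⟨θ, σ'⟩, ⟨⟨h1, h2⟩, h3⟩, he⟩
    simp only [Prod.mk.injEq] at h1 h2 h3 he
    obtain ⟨rfl, rfl⟩ := he
    have := hle _ h3
    refine ⟨h3, ?_, ?_⟩ <;> simp only <;> nlinarith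

lemma localBd {M R s t : ℝ} {ξ : ℝ → ℝ} {u : ℝ → ℝ → ℝ} (hM : 1 ≤ M)
    (hξ : ContinuousOn ξ (Icc s t)) (hle : ∀ σ ∈ Icc s t, ξ σ < R)
    (hu : ContinuousOn (fun p : ℝ × ℝ => u p.1 p.2)
      {p : ℝ × ℝ | p.2 ∈ Icc s t ∧ p.1 ∈ Icc (ξ p.2) R})
    (hPD : ∀ τ ∈ Ioc s t, ∀ x ∈ Ioo (ξ τ) R, PD M u x τ)
    (hR : ∀ σ ∈ Icc s t, 0 < u R σ) (hL : ∀ σ ∈ Icc s t, 0 ≤ u (ξ σ) σ)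
    (h0 : ∀ x ∈ Icc (ξ s) R, 0 ≤ u x s) :
    ∀ τ ∈ Ioc s t, ∀ x ∈ Ioo (ξ τ) R, u x τ ≠ 0 := by
  have hloc : ∀ τ ∈ Ioc s t, ∀ A, ξ τ < A → ∃ δ > 0, τ - δ ≥ s ∧ ∀ σ ∈ Icc (τ - δ) τ, ξ σ < A := by
    intro τ hτ A hA
    have h1 := (hξ τ ⟨hτ.1.le, hτ.2⟩).eventually (gt_mem_nhds hA)
    rw [eventually_nhdsWithin_iff, Metric.eventually_nhds_iff] at h1
    obtain ⟨δ, hδ, h1⟩ := h1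
    have hp : 0 < min δ (τ - s) := lt_min hδ (by linarith [hτ.1])
    have := min_le_left δ (τ - s)
    have := min_le_right δ (τ - s)
    refine ⟨min δ (τ - s) / 2, by linarith, by linarith, fun σ hσ => ?_⟩
    refine h1 ?_ ⟨by linarith [hσ.1], by linarith [hσ.2, hτ.2]⟩
    rw [Real.dist_eq, abs_lt]; constructor <;> linarith [hσ.1, hσ.2]
  have hnn := weakMP0 hM (compactD hξ fun σ hσ => (hle σ hσ).le) hu (by
    rintro ⟨x, τ⟩ ⟨hτ, hx1, hx2⟩
    simp only at hτ hx1 hx2 ⊢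
    rcases hτ.1.eq_or_lt with rfl | hτ1
    · exact Or.inl (h0 x ⟨hx1, hx2⟩)
    rcases hx1.eq_or_lt with rfl | hx1'
    · exact Or.inl (hL τ hτ)
    rcases hx2.eq_or_lt with rfl | hx2'
    · exact Or.inl (hR τ hτ).le
    right
    refine ⟨hPD τ ⟨hτ1, hτ.2⟩ x ⟨hx1', hx2'⟩, ?_⟩
    obtain ⟨δ, hδ, hδs, hδ'⟩ := hloc τ ⟨hτ1, hτ.2⟩ ((ξ τ + x) / 2) (by linarith)
    have d1 := min_le_left δ (min ((x - ξ τ) / 2) (R - x))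
    have d2 := (min_le_right δ (min ((x - ξ τ) / 2) (R - x))).trans (min_le_left _ _)
    have d3 := (min_le_right δ (min ((x - ξ τ) / 2) (R - x))).trans (min_le_right _ _)
    refine ⟨min δ (min ((x - ξ τ) / 2) (R - x)), lt_min hδ (lt_min (by linarith) (by linarith)), ?_⟩
    rintro x' ⟨e1, e2⟩ σ ⟨e3, e4⟩
    have := hδ' σ ⟨by linarith, e4⟩
    exact ⟨⟨by simp only; linarith, by simp only; linarith [hτ.2]⟩,
      ⟨by simp only; linarith, by simp only; linarith⟩⟩)
  intro τ hτ x hx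
  obtain ⟨δ, hδ, hδs, hδ'⟩ := hloc τ hτ ((ξ τ + x) / 2) (by linarith [hx.1])
  have hsub : Icc ((ξ τ + x) / 2) R ×ˢ Icc (τ - δ) τ ⊆
      {p : ℝ × ℝ | p.2 ∈ Icc s t ∧ p.1 ∈ Icc (ξ p.2) R} := by
    rintro p ⟨⟨h1, h2⟩, ⟨h3, h4⟩⟩
    exact ⟨⟨by linarith, by linarith [hτ.2]⟩, ⟨by linarith [hδ' p.2 ⟨h3, h4⟩], h2⟩⟩
  refine strongPos hM hδ (hu.mono hsub) ?_ (fun y hy σ hσ => hnn (y, σ) (hsub ⟨hy, hσ⟩))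
    (hR τ ⟨hτ.1.le, hτ.2⟩) x ⟨by linarith [hx.1], hx.2⟩
  intro y hy σ hσ
  exact hPD σ ⟨by linarith [hσ.1], by linarith [hσ.2, hτ.2]⟩ y
    ⟨by linarith [hδ' σ ⟨hσ.1.le, hσ.2⟩, hy.1], hy.2⟩

lemma ev_pos {f : ℝ → ℝ} {s t : ℝ} (hst : s < t) (hf : ContinuousOn f (Icc s t)) (h : 0 < f s) :
    ∃ t', s < t' ∧ t' ≤ t ∧ ∀ σ ∈ Icc s t', 0 < f σ := by
  have h1 := (hf s ⟨le_rfl, hst.le⟩).eventually (lt_mem_nhds h)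
  rw [eventually_nhdsWithin_iff, Metric.eventually_nhds_iff] at h1
  obtain ⟨δ, hδ, h1⟩ := h1
  have hp : 0 < min δ (t - s) := lt_min hδ (by linarith)
  have := min_le_left δ (t - s)
  have := min_le_right δ (t - s)
  refine ⟨s + min δ (t - s) / 2, by linarith, by linarith, fun σ hσ => ?_⟩
  refine h1 ?_ ⟨hσ.1, by linarith [hσ.2]⟩
  rw [Real.dist_eq, abs_lt]; constructor <;> linarith [hσ.1, hσ.2]

lemma localInt' {M L R s t z : ℝ} {u : ℝ → ℝ → ℝ} (hM : 1 ≤ M) (hst : s < t)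
    (hz : z ∈ Ioo L R)
    (hu : ContinuousOn (fun p : ℝ × ℝ => u p.1 p.2) (Icc L R ×ˢ Icc s t))
    (hPD : ∀ x ∈ Ioo L R, ∀ τ ∈ Ioc s t, PD M u x τ)
    (hz0 : u z s = 0) (hne : ∀ x ∈ Icc L R, x ≠ z → u x s ≠ 0) (hRp : 0 < u R s) :
    ∃ t' > s, ∀ τ ∈ Ioo s t', ∀ x ∈ Ioo L R, ∀ x' ∈ Ioo L R, u x τ = 0 → u x' τ = 0 → x = x' := by
  have hLR : L ≤ R := by linarith [hz.1, hz.2]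
  have hsl : ContinuousOn (fun x => u x s) (Icc L R) := slice_cont_s15 hu ⟨le_rfl, hst.le⟩
  have hright : ∀ x ∈ Icc L R, z ≤ x → 0 ≤ u x s := by
    intro x hx hzx
    rcases hzx.eq_or_lt with rfl | hzx
    · exact hz0.ge
    refine (constSign (f := fun x => u x s) hx.2 (hsl.mono (Icc_subset_Icc_left hx.1)) ?_ hRp).le
    intro y hy
    exact hne y ⟨by linarith [hx.1, hy.1], hy.2⟩ (by linarith [hy.1] : z < y).ne'
  obtain ⟨t1, ht1, ht1', hR⟩ := ev_pos hst (slice_cont'_s15 hu ⟨hLR, le_rfl⟩) hRp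
  rcases lt_or_gt_of_ne (hne L ⟨le_rfl, hLR⟩ hz.1.ne) with hLs | hLs
  · obtain ⟨t2, ht2, ht2', hL⟩ := ev_pos (f := fun σ => - u L σ) hst
      (slice_cont'_s15 hu ⟨le_rfl, hLR⟩).neg (by simpa using hLs)
    have hleft : ∀ x ∈ Icc L R, x ≤ z → u x s ≤ 0 := by
      intro x hx hzx
      rcases hzx.eq_or_lt with rfl | hzx
      · exact hz0.le
      by_contra hcon
      push Not at hcon
      have := constSign (f := fun x => u x s) hx.1 (hsl.mono (Icc_subset_Icc_right hx.2)) (by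
        intro y hy
        exact hne y ⟨hy.1, by linarith [hx.2, hy.2]⟩ (by linarith [hy.2] : y < z).ne) hcon
      linarith
    refine ⟨min t1 t2, lt_min ht1 ht2, fun τ hτ x hx x' hx' h h' => ?_⟩
    have q1 : τ < t1 := hτ.2.trans_le (min_le_left _ _)
    have q2 : τ < t2 := hτ.2.trans_le (min_le_right _ _)
    have hsub : Icc s τ ⊆ Icc s t := Icc_subset_Icc_right (by linarith)
    have key : ∀ x ∈ Ioo L R, ∀ x' ∈ Ioo L R, u x τ = 0 → u x' τ = 0 → ¬ x < x' := by
      intro x hx x' hx' h h'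
      exact uniqZero hM hτ.1 (hu.mono (prod_mono_right hsub))
        (fun x hx σ hσ => hPD x hx σ ⟨hσ.1, by linarith [hσ.2]⟩)
        (fun σ hσ => by have := hL σ ⟨hσ.1, by linarith [hσ.2]⟩; linarith)
        (fun σ hσ => hR σ ⟨hσ.1, by linarith [hσ.2]⟩) hleft hright hx hx' h h'
    exact le_antisymm (not_lt.1 (key x' hx' x hx h' h)) (not_lt.1 (key x hx x' hx' h h'))
  · obtain ⟨t2, ht2, ht2', hL⟩ := ev_pos hst (slice_cont'_s15 hu ⟨le_rfl, hLR⟩) hLs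
    have hleft : ∀ x ∈ Icc L R, x ≤ z → 0 ≤ u x s := by
      intro x hx hzx
      rcases hzx.eq_or_lt with rfl | hzx
      · exact hz0.ge
      by_contra hcon
      push Not at hcon
      have := constSign (f := fun x => - u x s) hx.1 (hsl.mono (Icc_subset_Icc_right hx.2)).neg (by
        intro y hy
        exact neg_ne_zero.2
          (hne y ⟨hy.1, by linarith [hx.2, hy.2]⟩ (by linarith [hy.2] : y < z).ne)) (by linarith)
      linarith
    refine ⟨min t1 t2, lt_min ht1 ht2, fun τ hτ x hx x' hx' h h' => ?_⟩
    have q1 : τ < t1 := hτ.2.trans_le (min_le_left _ _)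
    have q2 : τ < t2 := hτ.2.trans_le (min_le_right _ _)
    exfalso
    refine localBd (ξ := fun _ => L) (s := s) (t := τ) (R := R) hM continuousOn_const
      (fun _ _ => by linarith [hz.1, hz.2]) (hu.mono ?_)
      (fun σ hσ y hy => hPD y hy σ ⟨hσ.1, by linarith [hσ.2]⟩)
      (fun σ hσ => hR σ ⟨hσ.1, by linarith [hσ.2]⟩)
      (fun σ hσ => (hL σ ⟨hσ.1, by linarith [hσ.2]⟩).le) ?_ τ ⟨hτ.1, le_rfl⟩ x hx h
    · rintro p ⟨h1, h2⟩
      exact ⟨h2, ⟨h1.1, by linarith [h1.2]⟩⟩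
    · intro y hy
      rcases le_total y z with h | h
      · exact hleft y hy h
      · exact hright y hy h

lemma localInt {M L R s t z : ℝ} {u : ℝ → ℝ → ℝ} (hM : 1 ≤ M) (hst : s < t)
    (hz : z ∈ Ioo L R)
    (hu : ContinuousOn (fun p : ℝ × ℝ => u p.1 p.2) (Icc L R ×ˢ Icc s t))
    (hPD : ∀ x ∈ Ioo L R, ∀ τ ∈ Ioc s t, PD M u x τ)
    (hz0 : u z s = 0) (hne : ∀ x ∈ Icc L R, x ≠ z → u x s ≠ 0) :
    ∃ t' > s, ∀ τ ∈ Ioo s t', ∀ x ∈ Ioo L R, ∀ x' ∈ Ioo L R, u x τ = 0 → u x' τ = 0 → x = x' := by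
  have hR := hne R ⟨by linarith [hz.1, hz.2], le_rfl⟩ hz.2.ne'
  rcases lt_or_gt_of_ne hR with h | h
  · obtain ⟨t', ht', H⟩ := localInt' (u := fun x t => - u x t) hM hst hz hu.neg
      (fun x hx τ hτ => (hPD x hx τ hτ).neg) (by simp [hz0])
      (fun x hx hxz => neg_ne_zero.2 (hne x hx hxz)) (by linarith)
    exact ⟨t', ht', fun τ hτ x hx x' hx' e e' => H τ hτ x hx x' hx' (by simp [e]) (by simp [e'])⟩
  · exact localInt' hM hst hz hu hPD hz0 hne h

lemma PDmain {T X : ℝ} {xi1 : ℝ → ℝ} {a b c u : ℝ → ℝ → ℝ}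
    (hsol : IsClassicalSolution a b c xi1 (fun _ => X) T u)
    (hreg : Reg12 a b c xi1 (fun _ => X) T) :
    ∃ M : ℝ, 1 ≤ M ∧ ∀ t ∈ Ioc 0 T, ∀ x ∈ Ioo (xi1 t) X, PD M u x t := by
  obtain ⟨M, hM⟩ := hreg
  refine ⟨max M 1, le_max_right _ _, fun t ht x hx => ?_⟩
  have hp : (x, t) ∈ domLat xi1 (fun _ => X) T := ⟨ht, hx.1.le, hx.2.le⟩
  obtain ⟨h1, -, -, -, -, -, h2, h3, -, -, -, h4, -, -, h5⟩ := hM _ hp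
  refine ⟨?_, hsol.diff_xx _ hp, hsol.diff_t _ hp, a x t, b x t, c x t, ?_, ?_, ?_, ?_,
    hsol.eqn _ hp⟩
  · filter_upwards [Ioo_mem_nhds hx.1 hx.2] with y hy
    exact hsol.diff_x (y, t) ⟨ht, hy.1.le, hy.2.le⟩
  · have h6 : (a x t)⁻¹ ≤ max M 1 := (le_abs_self _).trans (h3.trans (le_max_left _ _))
    have := inv_anti₀ (inv_pos.2 h1) h6
    rwa [inv_inv] at this
  · exact (le_abs_self _).trans (h2.trans (le_max_left _ _))
  · exact h4.trans (le_max_left _ _)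
  · exact h5.trans (le_max_left _ _)

lemma bdPt {M T X s : ℝ} {xi1 : ℝ → ℝ} {u : ℝ → ℝ → ℝ} (hM : 1 ≤ M)
    (hxc : ContinuousOn xi1 (Icc s T)) (hxlt : ∀ t ∈ Icc s T, xi1 t < X) (hsT : s < T)
    (hu : ContinuousOn (fun p : ℝ × ℝ => u p.1 p.2) {p | p.2 ∈ Icc s T ∧ p.1 ∈ Icc (xi1 p.2) X})
    (hPD : ∀ t ∈ Ioc s T, ∀ x ∈ Ioo (xi1 t) X, PD M u x t)
    (hZ : u (xi1 s) s = 0) (hH3 : H3one u xi1 s) {d : ℝ} (hd : 0 < d) (hdX : xi1 s + d < X)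
    (hne : ∀ x ∈ Ioc (xi1 s) (xi1 s + d), u x s ≠ 0) (hpos : 0 < u (xi1 s + d) s) :
    ∃ e > 0, ∀ᶠ t in 𝓝[>] s, ∀ x ∈ Icc (xi1 t) X, u x t = 0 → |x - xi1 s| < e → x = xi1 t := by
  obtain ⟨ε, hε, δ, hδ, h3⟩ := hH3
  set R := xi1 s + d with hR
  have hsl : ContinuousOn (fun x => u x s) (Icc (xi1 s) R) := by
    refine hu.comp (f := fun x => (x, s)) (by fun_prop) ?_
    intro x hx
    exact ⟨⟨le_rfl, hsT.le⟩, hx.1, by simp; linarith [hx.2]⟩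
  have hp : ∀ x ∈ Ioc (xi1 s) R, 0 < u x s := by
    intro x hx
    exact constSign (f := fun x => u x s) hx.2 (hsl.mono (Icc_subset_Icc_left hx.1.le))
      (fun y hy => hne y ⟨hx.1.trans_le hy.1, hy.2⟩) hpos
  have hbd : ∀ t ∈ Ico s (s + ε), 0 ≤ u (xi1 t) t := by
    intro t ht
    rcases ht.1.eq_or_lt with rfl | hlt
    · exact hZ.ge
    set x := xi1 s + min d δ / 2 with hx
    have hmm : 0 < min d δ := lt_min hd hδ
    have m1 := min_le_left d δ
    have m2 := min_le_right d δ
    have h1 := h3 t ⟨hlt, ht.2⟩ x (by linarith) (by linarith)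
    have h2 := hp x ⟨by linarith, by linarith⟩
    by_contra hc
    push Not at hc
    nlinarith [mul_pos (neg_pos.2 hc) h2]
  obtain ⟨t1, ht1, ht1', hx1⟩ := ev_pos (f := fun σ => R - xi1 σ) hsT
    (continuousOn_const.sub hxc) (by simp [hR, hd])
  have hRc : ContinuousOn (fun σ => u R σ) (Icc s t1) := by
    refine hu.comp (f := fun σ => (R, σ)) (by fun_prop) ?_
    intro σ hσ
    have := hx1 σ hσ
    exact ⟨⟨hσ.1, hσ.2.trans ht1'⟩, by simp; linarith, hdX.le⟩
  obtain ⟨t2, ht2, ht2', hx2⟩ := ev_pos (f := fun σ => u R σ) ht1 hRc hpos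
  refine ⟨d, hd, ?_⟩
  filter_upwards [Ioo_mem_nhdsGT (lt_min ht2 (by linarith : s < s + ε))] with t ht x hx hx0 hxd
  have q1 : t < t2 := ht.2.trans_le (min_le_left _ _)
  have q2 : t < s + ε := ht.2.trans_le (min_le_right _ _)
  by_contra hcon
  refine localBd (ξ := xi1) (s := s) (t := t) (R := R) (u := u) hM
    (hxc.mono (Icc_subset_Icc_right (by linarith)))
    (fun σ hσ => by have := hx1 σ ⟨hσ.1, by linarith [hσ.2]⟩; linarith) (hu.mono ?_)
    (fun τ hτ y hy => hPD τ ⟨hτ.1, by linarith [hτ.2]⟩ y ⟨hy.1, by linarith [hy.2]⟩)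
    (fun σ hσ => hx2 σ ⟨hσ.1, by linarith [hσ.2]⟩)
    (fun σ hσ => hbd σ ⟨hσ.1, by linarith [hσ.2]⟩) ?_ t ⟨ht.1, le_rfl⟩ x
    ⟨lt_of_le_of_ne hx.1 (Ne.symm hcon), by linarith [(abs_lt.1 hxd).2]⟩ hx0
  · rintro p ⟨a1, a2⟩
    exact ⟨⟨a1.1, by linarith [a1.2]⟩, a2.1, by linarith [a2.2]⟩
  · intro y hy
    rcases hy.1.eq_or_lt with h | h
    · rw [← h, hZ]
    · exact (hp y ⟨h, hy.2⟩).le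

lemma isol {S : Set ℝ} (hS : S.Finite) (z : ℝ) : ∃ η > 0, ∀ x ∈ S, |x - z| < η → x = z := by
  have h1 : (S \ {z})ᶜ ∈ 𝓝 z := (hS.subset diff_subset).isClosed.isOpen_compl.mem_nhds (by simp)
  obtain ⟨η, hη, h⟩ := Metric.mem_nhds_iff.1 h1
  refine ⟨η, hη, fun x hx hxz => ?_⟩
  have := h (show x ∈ Metric.ball z η by rwa [Metric.mem_ball, Real.dist_eq])
  by_contra hne
  exact this ⟨hx, hne⟩

lemma mainAux {M T X s : ℝ} {xi1 : ℝ → ℝ} {u : ℝ → ℝ → ℝ} (hM : 1 ≤ M)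
    (hxc : ContinuousOn xi1 (Icc s T)) (hxlt : ∀ t ∈ Icc s T, xi1 t < X) (hsT : s < T)
    (hu : ContinuousOn (fun p : ℝ × ℝ => u p.1 p.2) {p | p.2 ∈ Icc s T ∧ p.1 ∈ Icc (xi1 p.2) X})
    (hPD : ∀ t ∈ Ioc s T, ∀ x ∈ Ioo (xi1 t) X, PD M u x t)
    (hX : u X s ≠ 0)
    (hZ : u (xi1 s) s = 0) (hH3 : H3one u xi1 s)
    (hS : (zeroSet u xi1 (fun _ => X) s).Finite) :
    ∀ᶠ t in 𝓝[>] s, Znum u xi1 (fun _ => X) t ≤ Znum u xi1 (fun _ => X) s := by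
  set S := zeroSet u xi1 (fun _ => X) s with hSdef
  have hss : s ∈ Icc s T := ⟨le_rfl, hsT.le⟩
  have hloc : ∀ z ∈ S, ∃ δ > 0, ∀ᶠ t in 𝓝[>] s, ∀ x ∈ Icc (xi1 t) X, ∀ x' ∈ Icc (xi1 t) X,
      u x t = 0 → u x' t = 0 → |x - z| < δ → |x' - z| < δ → x = x' := by
    intro z hz
    obtain ⟨η, hη, hiso⟩ := isol hS z
    have hzX : z < X := lt_of_le_of_ne hz.1.2 (by rintro rfl; exact hX hz.2)
    rcases hz.1.1.eq_or_lt with heq | hlt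
    · subst heq
      set d := min η (X - xi1 s) / 2 with hd
      have hmm : 0 < min η (X - xi1 s) := lt_min hη (by linarith)
      have m1 := min_le_left η (X - xi1 s)
      have m2 := min_le_right η (X - xi1 s)
      have hd0 : 0 < d := by linarith
      have hne : ∀ x ∈ Ioc (xi1 s) (xi1 s + d), u x s ≠ 0 := by
        intro x hx h0
        have := hiso x ⟨⟨hx.1.le, by simp; linarith [hx.2]⟩, h0⟩
          (by rw [abs_lt]; constructor <;> linarith [hx.1, hx.2])
        linarith [hx.1]
      have key : ∃ e > 0, ∀ᶠ t in 𝓝[>] s, ∀ x ∈ Icc (xi1 t) X, u x t = 0 →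
          |x - xi1 s| < e → x = xi1 t := by
        rcases lt_or_gt_of_ne (hne (xi1 s + d) ⟨by linarith, le_rfl⟩) with h | h
        · obtain ⟨e, he, H⟩ := bdPt (u := fun x t => - u x t) hM hxc hxlt hsT hu.neg
            (fun t ht x hx => (hPD t ht x hx).neg) (by simp [hZ])
            (by
              obtain ⟨ε, hε, δ, hδ, h3⟩ := hH3
              refine ⟨ε, hε, δ, hδ, fun t ht x h1 h2 => ?_⟩
              have := h3 t ht x h1 h2
              linarith) hd0 (by linarith)
            (fun x hx => neg_ne_zero.2 (hne x hx)) (by simpa using h)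
          refine ⟨e, he, H.mono fun t ht x hx h0 => ht x hx (by simp [h0])⟩
        · exact bdPt hM hxc hxlt hsT hu hPD hZ hH3 hd0 (by linarith) hne h
      obtain ⟨e, he, H⟩ := key
      refine ⟨e, he, H.mono fun t ht x hx x' hx' h0 h0' h1 h1' => ?_⟩
      rw [ht x hx h0 h1, ht x' hx' h0' h1']
    · set d := min η (min (X - z) (z - xi1 s)) / 2 with hd
      have hmm : 0 < min η (min (X - z) (z - xi1 s)) :=
        lt_min hη (lt_min (by linarith) (by linarith))
      have m1 := min_le_left η (min (X - z) (z - xi1 s))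
      have m2 := (min_le_right η (min (X - z) (z - xi1 s))).trans (min_le_left _ _)
      have m3 := (min_le_right η (min (X - z) (z - xi1 s))).trans (min_le_right _ _)
      have hd0 : 0 < d := by linarith
      obtain ⟨t1, ht1, ht1', hx1⟩ := ev_pos (f := fun σ => z - d - xi1 σ) hsT
        (continuousOn_const.sub hxc) (by simp; linarith)
      obtain ⟨t', ht', H⟩ := localInt (L := z - d) (R := z + d) (z := z) (u := u) hM ht1
        ⟨by linarith, by linarith⟩ (hu.mono (by
          rintro p ⟨p1, p2⟩
          have := hx1 p.2 p2
          exact ⟨⟨p2.1, by linarith [p2.2]⟩, by linarith [p1.1], by linarith [p1.2]⟩))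
        (fun x hx τ hτ => hPD τ ⟨hτ.1, by linarith [hτ.2]⟩ x
          ⟨by have := hx1 τ ⟨hτ.1.le, hτ.2⟩; linarith [hx.1], by linarith [hx.2]⟩) hz.2
        (by
          intro x hx hxz h0
          refine hxz (hiso x ⟨⟨by linarith [hx.1], by simp; linarith [hx.2]⟩, h0⟩ ?_)
          rw [abs_lt]; constructor <;> linarith [hx.1, hx.2])
      refine ⟨d, hd0, ?_⟩
      filter_upwards [Ioo_mem_nhdsGT ht'] with t ht x hx x' hx' h0 h0' h1 h1'
      rw [abs_lt] at h1 h1'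
      exact H t ht x ⟨by linarith, by linarith⟩ x' ⟨by linarith, by linarith⟩ h0 h0'
  choose! δ hδ hev using hloc
  have hall : ∀ᶠ t in 𝓝[>] s, ∀ z ∈ S, ∀ x ∈ Icc (xi1 t) X, ∀ x' ∈ Icc (xi1 t) X,
      u x t = 0 → u x' t = 0 → |x - z| < δ z → |x' - z| < δ z → x = x' :=
    (Filter.eventually_all_finite hS).2 hev
  have hcov : ∀ᶠ t in 𝓝[>] s, ∀ x ∈ Icc (xi1 t) X, u x t = 0 → ∃ z ∈ S, |x - z| < δ z := by
    set D := {p : ℝ × ℝ | p.2 ∈ Icc s T ∧ p.1 ∈ Icc (xi1 p.2) X} with hD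
    have hDc : IsCompact D := compactD hxc (fun σ hσ => (hxlt σ hσ).le)
    have h0 : IsCompact (D ∩ (fun p : ℝ × ℝ => u p.1 p.2) ⁻¹' {0}) :=
      hDc.of_isClosed_subset (hu.preimage_isClosed_of_isClosed hDc.isClosed isClosed_singleton)
        inter_subset_left
    have h1 : IsClosed {p : ℝ × ℝ | ∀ z ∈ S, δ z ≤ |p.1 - z|} := by
      simp only [setOf_forall]
      exact isClosed_biInter fun z _ => isClosed_le continuous_const (by fun_prop)
    have hK := ((h0.inter_right h1).image continuous_snd).isClosed
    have hn : s ∉ Prod.snd '' ((D ∩ (fun p : ℝ × ℝ => u p.1 p.2) ⁻¹' {0}) ∩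
        {p : ℝ × ℝ | ∀ z ∈ S, δ z ≤ |p.1 - z|}) := by
      rintro ⟨⟨x, t⟩, ⟨⟨hp1, hp2⟩, hp3⟩, rfl⟩
      have hxS : x ∈ S := ⟨hp1.2, hp2⟩
      have := hp3 x hxS
      have := hδ x hxS
      simp at *
      linarith
    filter_upwards [mem_nhdsWithin_of_mem_nhds (hK.isOpen_compl.mem_nhds hn),
      Ioo_mem_nhdsGT hsT] with t ht htT x hx hx0
    by_contra hcon
    push Not at hcon
    exact ht ⟨(x, t), ⟨⟨⟨⟨htT.1.le, htT.2.le⟩, hx⟩, hx0⟩, hcon⟩, rfl⟩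
  filter_upwards [hall, hcov] with t hA hC
  choose! g hg1 hg2 using hC
  refine Set.encard_le_encard_of_injOn (f := g) (fun x hx => hg1 x hx.1 hx.2) ?_
  intro x hx x' hx' he
  refine hA (g x) (hg1 x hx.1 hx.2) x hx.1 x' hx'.1 hx.2 hx'.2 (hg2 x hx.1 hx.2) ?_
  rw [he]; exact hg2 x' hx'.1 hx'.2

/-- Lemma 2.6: at a *ZZ- or *ZX-moment `s` of `w₁` (every right neighborhood of `s`
contains another Z-moment) satisfying (H3) with `Z(s) < ∞`, the number of zeroes
remains non-increasing: `Z(s) ≥ Z(t)` for all `t > s` sufficiently close to `s`. -/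
theorem starZZ_or_starZX_moment_nonincreasing
    (T X : ℝ) (xi1 : ℝ → ℝ) (a b c u : ℝ → ℝ → ℝ)
    (hT : 0 < T)
    (hxc : ContinuousOn xi1 (Icc 0 T)) (hxlt : ∀ t ∈ Icc (0:ℝ) T, xi1 t < X)
    (hsol : IsClassicalSolution a b c xi1 (fun _ => X) T u)
    (hreg : Reg12 a b c xi1 (fun _ => X) T)
    (hX : ∀ t ∈ Icc (0:ℝ) T, u X t ≠ 0)
    (hnz : ∀ t ∈ Icc (0:ℝ) T, ∃ x ∈ Icc (xi1 t) X, u x t ≠ 0)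
    (s : ℝ) (hs : s ∈ Ioo (0:ℝ) T)
    (hZ : u (xi1 s) s = 0)
    (hrZX : ∀ ε > 0, ∃ t ∈ Ioo s (s + ε), u (xi1 t) t = 0)
    (hH3 : H3one u xi1 s)
    (hfin : Znum u xi1 (fun _ => X) s < ⊤) :
    ∃ ε > 0, ∀ t ∈ Ioo s (s + ε),
      Znum u xi1 (fun _ => X) t ≤ Znum u xi1 (fun _ => X) s := by

  obtain ⟨M, hM, hPD⟩ := PDmain hsol hreg
  have hsub : Icc s T ⊆ Icc 0 T := Icc_subset_Icc_left hs.1.le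
  have h := mainAux (T := T) (X := X) hM (hxc.mono hsub) (fun t ht => hxlt t (hsub ht)) hs.2
    (hsol.cont.mono (fun p hp => ⟨hsub hp.1, hp.2⟩))
    (fun t ht x hx => hPD t ⟨hs.1.trans ht.1, ht.2⟩ x hx) (hX s ⟨hs.1.le, hs.2.le⟩) hZ hH3
    (Set.encard_lt_top_iff.1 hfin)
  obtain ⟨r, hr, h⟩ := (mem_nhdsGT_iff_exists_Ioo_subset).1 h
  refine ⟨r - s, sub_pos.2 hr, fun t ht => h ⟨ht.1, ?_⟩⟩
  have := ht.2
  linarith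
end
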